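/- arXiv:2501.08614 — 2 statements merged into one kernel-verified Lean document; each statement's English description precedes it below -/
import Mathlib

section
/- Let n ≥ 3 and let ξ₁,…,ξ_N be i.i.d. uniformly random points on S^{n−1}. Then for all sufficiently large N, 𝔼[max over facets F of [ξ₁,…,ξ_N] of vol_{n−1}(F)] ≥ c_n · (log N)/N, where c_n = (vol_{n−1}(S^{n−1})/vol_{n−1}(B₂^{n−1})) · (V₁ₙ³/V₂ₙ) · 2^{n²−n−7}/(3^{n+3}·π^{2n²−3n−1}) and V_{k,n} = 𝔼[(vol_{n−1}[ζ₁,…,ζ_n])^k] for ζ₁,…,ζ_n i.i.d. uniform on S^{n−2}. -/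
open MeasureTheory Metric

/-- The uniform probability measure on the unit sphere of `ℝⁿ`. -/
noncomputable def sphereUniform (n : ℕ) : Measure (EuclideanSpace ℝ (Fin n)) :=
  (μH[(n : ℝ) - 1] (sphere (0 : EuclideanSpace ℝ (Fin n)) 1))⁻¹ •
    (μH[(n : ℝ) - 1]).restrict (sphere (0 : EuclideanSpace ℝ (Fin n)) 1)

/-- `F` is a facet of the polytope `P ⊆ ℝⁿ`. -/
def IsFacet (n : ℕ) (P F : Set (EuclideanSpace ℝ (Fin n))) : Prop :=
  IsExposed ℝ P F ∧ Module.finrank ℝ (vectorSpan ℝ F) = n - 1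

/-- The maximal `(n-1)`-dimensional volume of a facet of `P`. -/
noncomputable def maxFacetVol (n : ℕ) (P : Set (EuclideanSpace ℝ (Fin n))) : ℝ :=
  sSup {v : ℝ | ∃ F, IsFacet n P F ∧ v = (μH[(n : ℝ) - 1] F).toReal}

/-- `V_{k,n}`: the `k`-th moment of the `(n-1)`-volume of the simplex spanned by
`n` i.i.d. uniform points on the unit sphere `S^{n-2} ⊂ ℝ^{n-1}`. -/
noncomputable def simplexMoment (n k : ℕ) : ℝ :=
  ∫ ζ : Fin n → EuclideanSpace ℝ (Fin (n - 1)),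
    ((volume (convexHull ℝ (Set.range ζ))).toReal) ^ k
    ∂(Measure.pi fun _ : Fin n => sphereUniform (n - 1))

open scoped ENNReal NNReal Pointwise

/-- Orthogonal projection onto the hyperplane orthogonal to a unit vector, in coordinates. -/
lemma exists_hyperplane_frame {d : ℕ} (u : EuclideanSpace ℝ (Fin (d + 1))) (hu : ‖u‖ = 1) :
    ∃ A : EuclideanSpace ℝ (Fin (d + 1)) →L[ℝ] EuclideanSpace ℝ (Fin d),
    ∃ ι : EuclideanSpace ℝ (Fin d) →ₗ[ℝ] EuclideanSpace ℝ (Fin (d + 1)),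
      ‖A‖ ≤ 1 ∧ (∀ x, ‖x‖ ^ 2 = inner ℝ u x ^ 2 + ‖A x‖ ^ 2) ∧ (∀ w, A (ι w) = w) ∧
      (∀ w, inner ℝ u (ι w) = 0) ∧ (∀ x w, inner ℝ x (ι w) = inner ℝ (A x) w) := by
  have : Fact (Module.finrank ℝ (EuclideanSpace ℝ (Fin (d + 1))) = d + 1) := ⟨by simp⟩
  have hu0 : u ≠ 0 := by rintro rfl; simp at hu
  set K := (Submodule.span ℝ {u})ᗮ with hK
  let e : K ≃ₗᵢ[ℝ] EuclideanSpace ℝ (Fin d) :=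
    (OrthonormalBasis.fromOrthogonalSpanSingleton (𝕜 := ℝ) d hu0).repr
  have hpy : ∀ x, ‖x‖ ^ 2 = inner ℝ u x ^ 2 + ‖e (K.orthogonalProjectionOnto x)‖ ^ 2 := by
    intro x
    rw [e.norm_map, Submodule.norm_sq_eq_add_norm_sq_projection x (Submodule.span ℝ {u})]
    congr 1
    change ‖(Submodule.span ℝ {u}).starProjection x‖ ^ 2 = _
    rw [Submodule.starProjection_unit_singleton ℝ hu, norm_smul, hu, mul_one, Real.norm_eq_abs, sq_abs]
  let A : EuclideanSpace ℝ (Fin (d + 1)) →L[ℝ] EuclideanSpace ℝ (Fin d) :=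
    (e.toContinuousLinearEquiv : K →L[ℝ] EuclideanSpace ℝ (Fin d)) ∘L K.orthogonalProjectionOnto
  refine ⟨A, K.subtype ∘ₗ (e.symm.toLinearEquiv : EuclideanSpace ℝ (Fin d) →ₗ[ℝ] K),
    ?_, ?_, ?_, ?_, ?_⟩
  · refine ContinuousLinearMap.opNorm_le_bound _ zero_le_one fun x => ?_
    have := hpy x
    rw [one_mul]
    refine abs_le_of_sq_le_sq' ?_ (norm_nonneg _) |>.2
    change ‖e (K.orthogonalProjectionOnto x)‖ ^ 2 ≤ _
    nlinarith [sq_nonneg (inner ℝ u x)]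
  · exact hpy
  · intro w; simp [A]
  · intro w
    exact Submodule.mem_orthogonal_singleton_iff_inner_right.1 (e.symm w).2
  · intro x w
    change inner ℝ x ((e.symm w : K) : EuclideanSpace ℝ (Fin (d + 1))) =
      inner ℝ (e (K.orthogonalProjectionOnto x)) w
    rw [← Submodule.inner_orthogonalProjectionOnto_eq_of_mem_right, ← e.inner_map_map, e.apply_symm_apply]

/-- A point of the unit sphere lying over a given point of a hyperplane. -/
lemma exists_mem_sphere_over {d : ℕ} {u : EuclideanSpace ℝ (Fin (d + 1))} (hu : ‖u‖ = 1)
    {A : EuclideanSpace ℝ (Fin (d + 1)) →L[ℝ] EuclideanSpace ℝ (Fin d)}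
    {ι : EuclideanSpace ℝ (Fin d) →ₗ[ℝ] EuclideanSpace ℝ (Fin (d + 1))}
    (hA : ∀ x, ‖x‖ ^ 2 = inner ℝ u x ^ 2 + ‖A x‖ ^ 2) (hι : ∀ w, A (ι w) = w)
    (hu' : ∀ w, inner ℝ u (ι w) = 0) {w : EuclideanSpace ℝ (Fin d)} (hw : ‖w‖ ≤ 1) :
    ∃ x ∈ sphere (0 : EuclideanSpace ℝ (Fin (d + 1))) 1, A x = w ∧
      ‖x - u‖ ^ 2 ≤ 2 * ‖w‖ ^ 2 := by
  have huu : inner ℝ u u = (1 : ℝ) := by rw [real_inner_self_eq_norm_sq, hu]; norm_num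
  have hAu : A u = 0 := by
    have := hA u
    rw [huu, hu] at this
    have h0 : ‖A u‖ ^ 2 = 0 := by linarith
    simpa using h0
  have h1 : 0 ≤ 1 - ‖w‖ ^ 2 := by nlinarith [norm_nonneg w]
  have hsq := Real.sq_sqrt h1
  set c := Real.sqrt (1 - ‖w‖ ^ 2)
  have hc : 0 ≤ c := Real.sqrt_nonneg _
  refine ⟨ι w + c • u, ?_, ?_, ?_⟩
  · have := hA (ι w + c • u)
    simp only [map_add, map_smul, hι, hAu, inner_add_right, inner_smul_right, hu', huu] at this
    have h2 : ‖ι w + c • u‖ ^ 2 = 1 := by rw [this]; simp; linarith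
    rw [mem_sphere_zero_iff_norm]
    nlinarith [norm_nonneg (ι w + c • u)]
  · simp [hι, hAu]
  · rw [hA]
    simp only [map_add, map_sub, map_smul, hι, hAu, inner_add_right, inner_sub_right,
      inner_smul_right, hu', huu]
    simp only [smul_zero, add_zero, sub_zero, zero_add, mul_one]
    nlinarith

/-- Projection of a small spherical cap onto the tangent hyperplane distorts distances by at most
a factor two. -/
lemma norm_sub_le_two_mul_of_mem_cap {d : ℕ} {u : EuclideanSpace ℝ (Fin (d + 1))}
    {A : EuclideanSpace ℝ (Fin (d + 1)) →L[ℝ] EuclideanSpace ℝ (Fin d)}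
    (hA : ∀ x, ‖x‖ ^ 2 = inner ℝ u x ^ 2 + ‖A x‖ ^ 2) {x y : EuclideanSpace ℝ (Fin (d + 1))}
    (hx : ‖x‖ = 1) (hy : ‖y‖ = 1) (hxu : ‖x - u‖ ≤ 1 / 2) (hyu : ‖y - u‖ ≤ 1 / 2) :
    ‖x - y‖ ≤ 2 * ‖A x - A y‖ := by
  have h1 : inner ℝ (x + y) (x - y) = 0 := by
    rw [real_inner_add_sub_eq_zero_iff, hx, hy]
  have h2 : 2 * inner ℝ u (x - y) = - inner ℝ ((x - u) + (y - u)) (x - y) := by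
    have : (x - u) + (y - u) = (x + y) - (2 : ℝ) • u := by module
    rw [this, inner_sub_left, h1, inner_smul_left]
    simp
  have h3 : |inner ℝ ((x - u) + (y - u)) (x - y)| ≤ ‖x - y‖ :=
    (abs_real_inner_le_norm _ _).trans
      (mul_le_of_le_one_left (norm_nonneg _) ((norm_add_le _ _).trans (by linarith)))
  have h4 : (inner ℝ u (x - y)) ^ 2 ≤ ‖x - y‖ ^ 2 / 4 := by
    have : (2 * inner ℝ u (x - y)) ^ 2 ≤ ‖x - y‖ ^ 2 := by
      rw [h2, neg_sq, ← sq_abs]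
      gcongr
    linarith
  have h5 := hA (x - y)
  rw [map_sub] at h5
  nlinarith [norm_nonneg (x - y), norm_nonneg (A x - A y)]

lemma hausdorffMeasure_isAddHaar (d : ℕ) :
    (μH[(d : ℝ)] : Measure (EuclideanSpace ℝ (Fin d))).IsAddHaarMeasure := by
  simpa using isAddHaarMeasure_hausdorffMeasure (E := EuclideanSpace ℝ (Fin d))

lemma hausdorffMeasure_ball {d : ℕ} {t : ℝ} (ht : 0 < t) :
    (μH[(d : ℝ)] : Measure (EuclideanSpace ℝ (Fin d))) (ball 0 t) =
      ENNReal.ofReal (t ^ d) * μH[(d : ℝ)] (ball (0 : EuclideanSpace ℝ (Fin d)) 1) := by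
  have := hausdorffMeasure_isAddHaar d
  rw [Measure.addHaar_ball_of_pos _ _ ht]
  simp

/-- Upper bound for the area of a spherical cap. -/
lemma hausdorffMeasure_cap_le {d : ℕ} {u : EuclideanSpace ℝ (Fin (d + 1))} (hu : ‖u‖ = 1)
    {t : ℝ} (ht : 0 < t) (ht' : t ≤ 1 / 2) :
    (μH[(d : ℝ)] : Measure (EuclideanSpace ℝ (Fin (d + 1)))) (sphere 0 1 ∩ ball u t) ≤
      ENNReal.ofReal ((2 * t) ^ d) * μH[(d : ℝ)] (ball (0 : EuclideanSpace ℝ (Fin d)) 1) := by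
  obtain ⟨A, ι, hA1, hA, hι, hu', -⟩ := exists_hyperplane_frame u hu
  set s : Set (EuclideanSpace ℝ (Fin (d + 1))) := sphere 0 1 ∩ ball u t
  have hanti : AntilipschitzWith 2 (fun x : s => A x) := by
    refine AntilipschitzWith.of_le_mul_dist fun x y => ?_
    rw [Subtype.dist_eq, dist_eq_norm, dist_eq_norm]
    have hx := x.2
    have hy := y.2
    refine norm_sub_le_two_mul_of_mem_cap hA (by simpa using hx.1) (by simpa using hy.1) ?_ ?_
    · rw [← dist_eq_norm]; exact (le_of_lt hx.2).trans ht'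
    · rw [← dist_eq_norm]; exact (le_of_lt hy.2).trans ht'
  have h1 := hanti.le_hausdorffMeasure_image (d := (d : ℝ)) (Nat.cast_nonneg d) Set.univ
  have h2 : μH[(d : ℝ)] (Set.univ : Set s) = μH[(d : ℝ)] s := by
    rw [← isometry_subtype_coe.hausdorffMeasure_image (Or.inl (Nat.cast_nonneg d))]
    simp
  rw [h2] at h1
  have hAu : A u = 0 := by
    have := hA u
    rw [real_inner_self_eq_norm_sq, hu] at this
    have h0 : ‖A u‖ ^ 2 = 0 := by linarith
    simpa using h0
  have h3 : (fun x : s => A x) '' Set.univ ⊆ ball 0 t := by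
    rintro _ ⟨x, -, rfl⟩
    rw [mem_ball_zero_iff]
    have hx : ‖(x : EuclideanSpace ℝ (Fin (d + 1))) - u‖ < t := by
      rw [← dist_eq_norm]; exact x.2.2
    calc ‖A x‖ = ‖A (x - u)‖ := by rw [map_sub, hAu, sub_zero]
      _ ≤ 1 * ‖(x : EuclideanSpace ℝ (Fin (d + 1))) - u‖ := A.le_of_opNorm_le hA1 _
      _ < t := by rwa [one_mul]
  refine h1.trans ((mul_le_mul_right (measure_mono h3) _).trans_eq ?_)
  rw [hausdorffMeasure_ball ht, ← mul_assoc, mul_pow, ENNReal.ofReal_mul (by positivity)]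
  congr 2
  rw [ENNReal.rpow_natCast, ENNReal.ofReal_pow (by norm_num)]
  simp

/-- Lower bound for the area of a spherical cap. -/
lemma le_hausdorffMeasure_cap {d : ℕ} {u : EuclideanSpace ℝ (Fin (d + 1))} (hu : ‖u‖ = 1)
    {t : ℝ} (ht : 0 < t) (ht' : t ≤ 2) :
    ENNReal.ofReal ((t / 2) ^ d) * μH[(d : ℝ)] (ball (0 : EuclideanSpace ℝ (Fin d)) 1) ≤
      (μH[(d : ℝ)] : Measure (EuclideanSpace ℝ (Fin (d + 1)))) (sphere 0 1 ∩ ball u t) := by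
  obtain ⟨A, ι, hA1, hA, hι, hu', -⟩ := exists_hyperplane_frame u hu
  have hsub : ball 0 (t / 2) ⊆ A '' (sphere 0 1 ∩ ball u t) := by
    intro w hw
    rw [mem_ball_zero_iff] at hw
    obtain ⟨x, hx, hxw, hxu⟩ := exists_mem_sphere_over hu hA hι hu' (w := w) (by linarith)
    refine ⟨x, ⟨hx, ?_⟩, hxw⟩
    rw [mem_ball, dist_eq_norm]
    nlinarith [norm_nonneg w, norm_nonneg (x - u)]
  have hL : LipschitzWith 1 A := A.lipschitz.weaken (by exact_mod_cast hA1)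
  have h := hL.hausdorffMeasure_image_le (d := (d : ℝ)) (Nat.cast_nonneg d) (sphere 0 1 ∩ ball u t)
  rw [← hausdorffMeasure_ball (by positivity)]
  refine (measure_mono hsub).trans (h.trans_eq ?_)
  simp

lemma hausdorffMeasure_ball_pos_lt_top (d : ℕ) :
    0 < (μH[(d : ℝ)] : Measure (EuclideanSpace ℝ (Fin d))) (ball 0 1) ∧
      (μH[(d : ℝ)] : Measure (EuclideanSpace ℝ (Fin d))) (ball 0 1) < ∞ := by
  have := hausdorffMeasure_isAddHaar d
  exact ⟨measure_ball_pos _ _ one_pos, measure_ball_lt_top⟩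

lemma hausdorffMeasure_sphere_pos_lt_top (d : ℕ) :
    0 < (μH[(d : ℝ)] : Measure (EuclideanSpace ℝ (Fin (d + 1)))) (sphere 0 1) ∧
      (μH[(d : ℝ)] : Measure (EuclideanSpace ℝ (Fin (d + 1)))) (sphere 0 1) < ∞ := by
  obtain ⟨h0, h1⟩ := hausdorffMeasure_ball_pos_lt_top d
  constructor
  · have hu : ‖(EuclideanSpace.single 0 1 : EuclideanSpace ℝ (Fin (d + 1)))‖ = 1 := by simp
    refine lt_of_lt_of_le ?_ ((le_hausdorffMeasure_cap hu one_pos one_le_two).trans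
      (measure_mono Set.inter_subset_left))
    exact ENNReal.mul_pos (by simp) h0.ne'
  · refine (isCompact_sphere _ _).measure_lt_top_of_nhdsWithin fun x hx => ?_
    refine ⟨sphere 0 1 ∩ ball x (1 / 2), ?_, ?_⟩
    · exact inter_mem_nhdsWithin _ (ball_mem_nhds _ (by norm_num))
    · refine (hausdorffMeasure_cap_le (by simpa using hx) (by norm_num) le_rfl).trans_lt ?_
      exact ENNReal.mul_lt_top ENNReal.ofReal_lt_top h1

/-- Caps of the same radius have the same area. -/
lemma hausdorffMeasure_cap_eq {d : ℕ} {u v : EuclideanSpace ℝ (Fin (d + 1))} (hu : ‖u‖ = 1)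
    (hv : ‖v‖ = 1) (t : ℝ) :
    (μH[(d : ℝ)] : Measure (EuclideanSpace ℝ (Fin (d + 1)))) (sphere 0 1 ∩ ball u t) =
      μH[(d : ℝ)] (sphere 0 1 ∩ ball v t) := by
  let e := (Submodule.span ℝ {u - v})ᗮ.reflection
  have he : e u = v := Submodule.reflection_sub (hu.trans hv.symm)
  rw [← e.isometry.hausdorffMeasure_image (Or.inl (Nat.cast_nonneg d)) (sphere 0 1 ∩ ball u t),
    Set.image_inter e.injective, e.image_sphere, e.image_ball, he, map_zero]

lemma natCast_succ_sub_one (d : ℕ) : ((d + 1 : ℕ) : ℝ) - 1 = d := by simp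

lemma sphereUniform_apply {d : ℕ} {s : Set (EuclideanSpace ℝ (Fin (d + 1)))}
    (hs : MeasurableSet s) :
    sphereUniform (d + 1) s = (μH[(d : ℝ)] (sphere (0 : EuclideanSpace ℝ (Fin (d + 1))) 1))⁻¹ *
      μH[(d : ℝ)] (sphere 0 1 ∩ s) := by
  rw [sphereUniform, natCast_succ_sub_one, Measure.smul_apply, Measure.restrict_apply hs,
    smul_eq_mul, Set.inter_comm]

instance isProbabilityMeasure_sphereUniform (d : ℕ) :
    IsProbabilityMeasure (sphereUniform (d + 1)) := by
  obtain ⟨h0, h1⟩ := hausdorffMeasure_sphere_pos_lt_top d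
  refine ⟨?_⟩
  rw [sphereUniform_apply MeasurableSet.univ, Set.inter_univ]
  exact ENNReal.inv_mul_cancel h0.ne' h1.ne

lemma ae_mem_sphere (d : ℕ) : ∀ᵐ x ∂sphereUniform (d + 1), ‖x‖ = 1 := by
  have h : sphereUniform (d + 1) (sphere 0 1)ᶜ = 0 := by
    rw [sphereUniform_apply isClosed_sphere.measurableSet.compl]
    simp
  filter_upwards [compl_mem_ae_iff.2 h] with x hx
  simpa using hx

lemma sphereUniform_ball_eq {d : ℕ} {u v : EuclideanSpace ℝ (Fin (d + 1))} (hu : ‖u‖ = 1)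
    (hv : ‖v‖ = 1) (t : ℝ) :
    sphereUniform (d + 1) (ball u t) = sphereUniform (d + 1) (ball v t) := by
  rw [sphereUniform_apply measurableSet_ball, sphereUniform_apply measurableSet_ball,
    hausdorffMeasure_cap_eq hu hv]

lemma sphereUniform_real_ball {d : ℕ} (u : EuclideanSpace ℝ (Fin (d + 1))) (t : ℝ) :
    (sphereUniform (d + 1)).real (ball u t) =
      (μH[(d : ℝ)] (sphere 0 1 ∩ ball u t)).toReal /
        (μH[(d : ℝ)] (sphere (0 : EuclideanSpace ℝ (Fin (d + 1))) 1)).toReal := by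
  rw [measureReal_def, sphereUniform_apply measurableSet_ball, ENNReal.toReal_mul,
    ENNReal.toReal_inv, inv_mul_eq_div]

lemma sphereUniform_real_ball_le {d : ℕ} {u : EuclideanSpace ℝ (Fin (d + 1))} (hu : ‖u‖ = 1)
    {t : ℝ} (ht : 0 < t) (ht' : t ≤ 1 / 2) :
    (sphereUniform (d + 1)).real (ball u t) ≤
      (2 * t) ^ d * (μH[(d : ℝ)] (ball (0 : EuclideanSpace ℝ (Fin d)) 1)).toReal /
        (μH[(d : ℝ)] (sphere (0 : EuclideanSpace ℝ (Fin (d + 1))) 1)).toReal := by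
  rw [sphereUniform_real_ball]
  gcongr
  refine (ENNReal.toReal_mono ?_ (hausdorffMeasure_cap_le hu ht ht')).trans_eq ?_
  · exact ENNReal.mul_ne_top ENNReal.ofReal_ne_top (hausdorffMeasure_ball_pos_lt_top d).2.ne
  · rw [ENNReal.toReal_mul, ENNReal.toReal_ofReal (by positivity)]

lemma le_sphereUniform_real_ball {d : ℕ} {u : EuclideanSpace ℝ (Fin (d + 1))} (hu : ‖u‖ = 1)
    {t : ℝ} (ht : 0 < t) (ht' : t ≤ 2) :
    (t / 2) ^ d * (μH[(d : ℝ)] (ball (0 : EuclideanSpace ℝ (Fin d)) 1)).toReal /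
        (μH[(d : ℝ)] (sphere (0 : EuclideanSpace ℝ (Fin (d + 1))) 1)).toReal ≤
      (sphereUniform (d + 1)).real (ball u t) := by
  rw [sphereUniform_real_ball]
  gcongr
  refine Eq.trans_le ?_ (ENNReal.toReal_mono ?_ (le_hausdorffMeasure_cap hu ht ht'))
  · rw [ENNReal.toReal_mul, ENNReal.toReal_ofReal (by positivity)]
  · exact ((measure_mono Set.inter_subset_left).trans_lt
      (hausdorffMeasure_sphere_pos_lt_top d).2).ne

/-- The set of point configurations whose convex hull has measure at least `c` is closed. -/
lemma isClosed_le_measure_convexHull {κ E : Type*} [Finite κ] [NormedAddCommGroup E]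
    [NormedSpace ℝ E] [FiniteDimensional ℝ E] [MeasurableSpace E] [BorelSpace E]
    (μ : Measure E) [IsFiniteMeasureOnCompacts μ] (c : ℝ≥0∞) :
    IsClosed {w : κ → E | c ≤ μ (convexHull ℝ (Set.range w))} := by
  have := Fintype.ofFinite κ
  rw [← isOpen_compl_iff, Metric.isOpen_iff]
  intro w hw
  simp only [Set.mem_compl_iff, Set.mem_ofPred_eq, not_le] at hw
  have hK : IsCompact (convexHull ℝ (Set.range w)) := (Set.finite_range w).isCompact_convexHull ℝ
  have ht := tendsto_measure_cthickening_of_isCompact (μ := μ) hK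
  have hev := (ht.mono_left (nhdsWithin_le_nhds (s := Set.Ioi (0 : ℝ)))).eventually_lt_const hw
  obtain ⟨δ, hδ, hδ0⟩ := (hev.and self_mem_nhdsWithin).exists
  refine ⟨δ, hδ0, fun w' hw' => ?_⟩
  simp only [Set.mem_compl_iff, Set.mem_ofPred_eq, not_le]
  refine (measure_mono (convexHull_min ?_ ((convex_convexHull ℝ _).cthickening δ))).trans_lt hδ
  rintro _ ⟨i, rfl⟩
  refine mem_cthickening_of_dist_le _ (w i) _ _ (subset_convexHull ℝ _ ⟨i, rfl⟩) ?_
  exact (dist_le_pi_dist w' w i).trans hw'.le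

/-- A set spanning at most a hyperplane is orthogonal to some unit vector. -/
lemma exists_unit_normal {d : ℕ} {F : Set (EuclideanSpace ℝ (Fin (d + 1)))}
    (hF : Module.finrank ℝ (vectorSpan ℝ F) = d) :
    ∃ u : EuclideanSpace ℝ (Fin (d + 1)), ‖u‖ = 1 ∧ ∀ x ∈ F, ∀ y ∈ F, inner ℝ u x = inner ℝ u y := by
  have h1 : vectorSpan ℝ F ≠ ⊤ := by
    intro h
    rw [h, finrank_top] at hF
    simp at hF
  have h2 : (vectorSpan ℝ F)ᗮ ≠ ⊥ := fun h => h1 (Submodule.orthogonal_eq_bot_iff.1 h)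
  obtain ⟨v, hv, hv0⟩ := Submodule.exists_mem_ne_zero_of_ne_bot h2
  refine ⟨‖v‖⁻¹ • v, ?_, fun x hx y hy => ?_⟩
  · rw [norm_smul, norm_inv, norm_norm, inv_mul_cancel₀ (norm_ne_zero_iff.2 hv0)]
  · have h3 := (Submodule.mem_orthogonal' _ _).1 hv (x - y) (vsub_mem_vectorSpan ℝ hx hy)
    rw [inner_smul_left, inner_smul_left]
    rw [inner_sub_right, sub_eq_zero] at h3
    rw [h3]

/-- Projection along a normal direction preserves the area of flat sets. -/
lemma hausdorffMeasure_image_of_flat {d : ℕ} {u : EuclideanSpace ℝ (Fin (d + 1))}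
    {A : EuclideanSpace ℝ (Fin (d + 1)) →L[ℝ] EuclideanSpace ℝ (Fin d)}
    (hA : ∀ x, ‖x‖ ^ 2 = inner ℝ u x ^ 2 + ‖A x‖ ^ 2) {F : Set (EuclideanSpace ℝ (Fin (d + 1)))}
    (hF : ∀ x ∈ F, ∀ y ∈ F, inner ℝ u x = inner ℝ u y) :
    (μH[(d : ℝ)] : Measure (EuclideanSpace ℝ (Fin d))) (A '' F) = μH[(d : ℝ)] F := by
  have hiso : Isometry (fun x : F => A x) := by
    refine Isometry.of_dist_eq fun x y => ?_
    rw [Subtype.dist_eq, dist_eq_norm, dist_eq_norm, ← map_sub]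
    have := hA ((x : EuclideanSpace ℝ (Fin (d + 1))) - y)
    rw [inner_sub_right, hF x x.2 y y.2, sub_self] at this
    nlinarith [norm_nonneg ((x : EuclideanSpace ℝ (Fin (d + 1))) - y),
      norm_nonneg (A ((x : EuclideanSpace ℝ (Fin (d + 1))) - y))]
  have h1 := hiso.hausdorffMeasure_image (d := (d : ℝ)) (Or.inl (Nat.cast_nonneg d)) Set.univ
  have h2 := (isometry_subtype_coe (s := F)).hausdorffMeasure_image (d := (d : ℝ))
    (Or.inl (Nat.cast_nonneg d)) Set.univ
  have h3 : (fun x : F => A x) '' Set.univ = A '' F := by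
    ext; simp
  rw [h3] at h1
  rw [h1, ← h2]
  simp

lemma hausdorffMeasure_flat_le {d : ℕ} {F : Set (EuclideanSpace ℝ (Fin (d + 1)))}
    (hF : Module.finrank ℝ (vectorSpan ℝ F) = d) {R : ℝ} (hR : F ⊆ closedBall 0 R) :
    (μH[(d : ℝ)] : Measure (EuclideanSpace ℝ (Fin (d + 1)))) F ≤
      μH[(d : ℝ)] (closedBall (0 : EuclideanSpace ℝ (Fin d)) R) := by
  obtain ⟨u, hu, huF⟩ := exists_unit_normal hF
  obtain ⟨A, ι, hA1, hA, -⟩ := exists_hyperplane_frame u hu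
  rw [← hausdorffMeasure_image_of_flat hA huF]
  refine measure_mono ?_
  rintro _ ⟨x, hx, rfl⟩
  have := hR hx
  rw [mem_closedBall_zero_iff] at this ⊢
  exact ((A.le_of_opNorm_le hA1 x).trans_eq (one_mul _)).trans this

lemma facet_volume_le {d : ℕ} {P : Set (EuclideanSpace ℝ (Fin (d + 1)))} {R : ℝ}
    (hP : P ⊆ closedBall 0 R) {F : Set (EuclideanSpace ℝ (Fin (d + 1)))}
    (hF : IsFacet (d + 1) P F) :
    μH[(d : ℝ)] F < ∞ ∧ (μH[(d : ℝ)] F).toReal ≤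
      (μH[(d : ℝ)] (closedBall (0 : EuclideanSpace ℝ (Fin d)) R)).toReal := by
  have := hausdorffMeasure_isAddHaar d
  have hfin : (μH[(d : ℝ)] : Measure (EuclideanSpace ℝ (Fin d))) (closedBall 0 R) < ∞ :=
    measure_closedBall_lt_top
  have hle := hausdorffMeasure_flat_le (by simpa using hF.2) (hF.1.subset.trans hP)
  exact ⟨hle.trans_lt hfin, ENNReal.toReal_mono hfin.ne hle⟩

lemma maxFacetVol_nonneg (n : ℕ) (P : Set (EuclideanSpace ℝ (Fin n))) : 0 ≤ maxFacetVol n P := by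
  refine Real.sSup_nonneg ?_
  rintro _ ⟨F, -, rfl⟩
  exact ENNReal.toReal_nonneg

lemma maxFacetVol_le {d : ℕ} {P : Set (EuclideanSpace ℝ (Fin (d + 1)))} {R : ℝ}
    (hP : P ⊆ closedBall 0 R) :
    maxFacetVol (d + 1) P ≤ (μH[(d : ℝ)] (closedBall (0 : EuclideanSpace ℝ (Fin d)) R)).toReal := by
  refine Real.sSup_le ?_ ENNReal.toReal_nonneg
  rintro _ ⟨F, hF, rfl⟩
  rw [natCast_succ_sub_one]
  exact (facet_volume_le hP hF).2

lemma le_maxFacetVol {d : ℕ} {P : Set (EuclideanSpace ℝ (Fin (d + 1)))}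
    (hP : Bornology.IsBounded P) {F : Set (EuclideanSpace ℝ (Fin (d + 1)))}
    (hF : IsFacet (d + 1) P F) : (μH[(d : ℝ)] F).toReal ≤ maxFacetVol (d + 1) P := by
  obtain ⟨R, hR⟩ := hP.subset_closedBall 0
  refine le_csSup ⟨(μH[(d : ℝ)] (closedBall (0 : EuclideanSpace ℝ (Fin d)) R)).toReal, ?_⟩
    ⟨F, hF, by rw [natCast_succ_sub_one]⟩
  rintro _ ⟨F, hF, rfl⟩
  rw [natCast_succ_sub_one]
  exact (facet_volume_le hR hF).2

/-- If the points `ω i`, `i ∈ I`, lie on a supporting hyperplane, then the area of any contraction of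
their convex hull into `ℝᵈ` is a lower bound for the maximal facet volume. -/
lemma le_maxFacetVol_of_support {d N : ℕ} (ω : Fin N → EuclideanSpace ℝ (Fin (d + 1)))
    {ν : EuclideanSpace ℝ (Fin (d + 1))} (hν : ν ≠ 0) {I : Set (Fin N)}
    (hI : ∀ i ∈ I, ∀ j, inner ℝ ν (ω j) ≤ inner ℝ ν (ω i))
    {A : EuclideanSpace ℝ (Fin (d + 1)) →L[ℝ] EuclideanSpace ℝ (Fin d)} (hA : ‖A‖ ≤ 1)
    (hpos : 0 < μH[(d : ℝ)] (convexHull ℝ (Set.range fun i : I => A (ω i)))) :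
    (μH[(d : ℝ)] (convexHull ℝ (Set.range fun i : I => A (ω i)))).toReal ≤
      maxFacetVol (d + 1) (convexHull ℝ (Set.range ω)) := by
  have := hausdorffMeasure_isAddHaar d
  set P := convexHull ℝ (Set.range ω) with hP
  have hPc : IsCompact P := (Set.finite_range ω).isCompact_convexHull ℝ
  set F := (innerSL ℝ ν).toExposed P with hF
  have hFexp : IsExposed ℝ P F := ContinuousLinearMap.toExposed.isExposed
  have hFconv : Convex ℝ F := hFexp.convex (convex_convexHull ℝ _)
  have hmem : ∀ i ∈ I, ω i ∈ F := by
    intro i hi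
    refine ⟨subset_convexHull ℝ _ ⟨i, rfl⟩, fun y hy => ?_⟩
    have hsub : P ⊆ {y | innerSL ℝ ν y ≤ innerSL ℝ ν (ω i)} := by
      refine convexHull_min ?_ (convex_halfSpace_le (innerSL ℝ ν).isLinear _)
      rintro _ ⟨j, rfl⟩
      simpa using hI i hi j
    exact hsub hy
  have hAF : convexHull ℝ (Set.range fun i : I => A (ω i)) ⊆ A '' F := by
    refine convexHull_min ?_ (hFconv.linear_image A.toLinearMap)
    rintro _ ⟨i, rfl⟩
    exact ⟨ω i, hmem i i.2, rfl⟩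
  have hAFpos : 0 < μH[(d : ℝ)] (A '' F) := hpos.trans_le (measure_mono hAF)
  have hle : Module.finrank ℝ (vectorSpan ℝ F) ≤ d := by
    have : Fact (Module.finrank ℝ (EuclideanSpace ℝ (Fin (d + 1))) = d + 1) := ⟨by simp⟩
    refine le_of_le_of_eq (Submodule.finrank_mono (Submodule.span_le.2 ?_))
      (Submodule.finrank_orthogonal_span_singleton (𝕜 := ℝ) (n := d) hν)
    rintro _ ⟨x, hx, y, hy, rfl⟩
    rw [SetLike.mem_coe, Submodule.mem_orthogonal_singleton_iff_inner_right]
    change inner ℝ ν (x - y) = 0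
    rw [inner_sub_right, sub_eq_zero]
    exact le_antisymm (hy.2 x hx.1) (hx.2 y hy.1)
  have hge : d ≤ Module.finrank ℝ (vectorSpan ℝ F) := by
    have h1 : affineSpan ℝ (A '' F) = ⊤ := by
      by_contra h
      have h0 := Measure.addHaar_affineSubspace (μH[(d : ℝ)]) _ h
      exact hAFpos.ne' (measure_mono_null (subset_affineSpan ℝ _) h0)
    have h2 := AffineSubspace.vectorSpan_eq_top_of_affineSpan_eq_top _ _ _ h1
    have h3 : vectorSpan ℝ (A '' F) = (vectorSpan ℝ F).map A.toLinearMap := by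
      have := (A.toLinearMap.toAffineMap).map_vectorSpan (s := F)
      simpa using this.symm
    have h4 := Submodule.finrank_map_le A.toLinearMap (vectorSpan ℝ F)
    rw [← h3, h2, finrank_top] at h4
    simpa using h4
  have hfacet : IsFacet (d + 1) P F := ⟨hFexp, by simpa using le_antisymm hle hge⟩
  obtain ⟨R, hR⟩ := hPc.isBounded.subset_closedBall 0
  refine le_trans (ENNReal.toReal_mono (facet_volume_le hR hfacet).1.ne ?_)
    (le_maxFacetVol hPc.isBounded hfacet)
  have hL : LipschitzWith 1 A := A.lipschitz.weaken (by exact_mod_cast hA)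
  refine (measure_mono hAF).trans
    ((hL.hausdorffMeasure_image_le (d := (d : ℝ)) (Nat.cast_nonneg d) F).trans_eq ?_)
  simp

lemma IsExposed.eq_convexHull_image {d N : ℕ} {ω : Fin N → EuclideanSpace ℝ (Fin d)}
    {F : Set (EuclideanSpace ℝ (Fin d))} (hF : IsExposed ℝ (convexHull ℝ (Set.range ω)) F) :
    F = convexHull ℝ (Set.range fun i : {i | ω i ∈ F} => ω i) := by
  have hPc : IsCompact (convexHull ℝ (Set.range ω)) := (Set.finite_range ω).isCompact_convexHull ℝ
  have hFconv : Convex ℝ F := hF.convex (convex_convexHull ℝ _)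
  refine Set.Subset.antisymm ?_ (convexHull_min ?_ hFconv)
  · refine (closure_convexHull_extremePoints (hF.isCompact hPc) hFconv).symm.subset.trans ?_
    refine closure_minimal (convexHull_mono fun x hx => ?_)
      ((Set.finite_range _).isCompact_convexHull ℝ).isClosed
    obtain ⟨i, rfl⟩ := extremePoints_convexHull_subset
      (hF.isExtreme.extremePoints_subset_extremePoints hx)
    exact ⟨⟨i, hx.1⟩, rfl⟩
  · rintro _ ⟨i, rfl⟩
    exact i.2

/-- Every facet is spanned by points on a supporting hyperplane and can be projected isometrically
to `ℝᵈ`. -/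
lemma IsFacet.exists_support {d N : ℕ} {ω : Fin N → EuclideanSpace ℝ (Fin (d + 1))}
    {F : Set (EuclideanSpace ℝ (Fin (d + 1)))}
    (hF : IsFacet (d + 1) (convexHull ℝ (Set.range ω)) F) (hne : F.Nonempty) :
    ∃ ν : EuclideanSpace ℝ (Fin (d + 1)), ‖ν‖ = 1 ∧
    ∃ A : EuclideanSpace ℝ (Fin (d + 1)) →L[ℝ] EuclideanSpace ℝ (Fin d), ‖A‖ ≤ 1 ∧
      (∀ i ∈ {i | ω i ∈ F}, ∀ j, inner ℝ ν (ω j) ≤ inner ℝ ν (ω i)) ∧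
      μH[(d : ℝ)] (convexHull ℝ (Set.range fun i : {i | ω i ∈ F} => A (ω i))) = μH[(d : ℝ)] F := by
  have hdim : Module.finrank ℝ (vectorSpan ℝ F) = d := by simpa using hF.2
  obtain ⟨u, hu, huF⟩ := exists_unit_normal hdim
  obtain ⟨A, ι, hA1, hA, -⟩ := exists_hyperplane_frame u hu
  have hvol : μH[(d : ℝ)] (convexHull ℝ (Set.range fun i : {i | ω i ∈ F} => A (ω i))) =
      μH[(d : ℝ)] F := by
    rw [← hausdorffMeasure_image_of_flat hA huF]
    conv_rhs => rw [hF.1.eq_convexHull_image]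
    congr 1
    have := A.toLinearMap.image_convexHull (Set.range fun i : {i | ω i ∈ F} => ω i)
    rw [← Set.range_comp] at this
    exact this.symm
  obtain ⟨l, hl⟩ := hF.1 hne
  by_cases hl0 : l = 0
  · refine ⟨u, hu, A, hA1, fun i hi j => ?_, hvol⟩
    have hj : ω j ∈ F := by
      rw [hl]
      exact ⟨subset_convexHull ℝ _ ⟨j, rfl⟩, by simp [hl0]⟩
    exact (huF _ hj _ hi).le
  · set v := (InnerProductSpace.toDual ℝ (EuclideanSpace ℝ (Fin (d + 1)))).symm l with hv
    have hv0 : v ≠ 0 := by simpa [hv] using hl0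
    have hlv : ∀ x, inner ℝ v x = l x := fun x => InnerProductSpace.toDual_symm_apply
    refine ⟨‖v‖⁻¹ • v, ?_, A, hA1, fun i hi j => ?_, hvol⟩
    · rw [norm_smul, norm_inv, norm_norm, inv_mul_cancel₀ (norm_ne_zero_iff.2 hv0)]
    · rw [inner_smul_left, inner_smul_left, hlv, hlv]
      have hi' : ω i ∈ F := hi
      rw [hl] at hi'
      have := hi'.2 (ω j) (subset_convexHull ℝ _ ⟨j, rfl⟩)
      refine mul_le_mul_of_nonneg_left this ?_
      simp

lemma exists_facet_of_le_maxFacetVol {d N : ℕ} {ω : Fin N → EuclideanSpace ℝ (Fin (d + 1))}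
    {c : ℝ} (hc : 0 < c) (h : c ≤ maxFacetVol (d + 1) (convexHull ℝ (Set.range ω))) :
    ∃ F, IsFacet (d + 1) (convexHull ℝ (Set.range ω)) F ∧ c ≤ (μH[(d : ℝ)] F).toReal := by
  rw [maxFacetVol] at h
  simp only [natCast_succ_sub_one] at h
  set V := {v : ℝ | ∃ F, IsFacet (d + 1) (convexHull ℝ (Set.range ω)) F ∧
    v = (μH[(d : ℝ)] F).toReal} with hV
  have hfin : V.Finite := by
    refine (Set.finite_range fun I : Set (Fin N) =>
      (μH[(d : ℝ)] (convexHull ℝ (Set.range fun i : I => ω i))).toReal).subset ?_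
    rintro _ ⟨F, hF, rfl⟩
    exact ⟨{i | ω i ∈ F}, by simp only; rw [← hF.1.eq_convexHull_image]⟩
  have hne : V.Nonempty := by
    by_contra hne
    rw [Set.not_nonempty_iff_eq_empty.1 hne, Real.sSup_empty] at h
    exact hc.not_ge h
  obtain ⟨F, hF, hFv⟩ := hne.csSup_mem hfin
  exact ⟨F, hF, hFv ▸ h⟩

lemma isClosed_le_maxFacetVol {d N : ℕ} {c : ℝ} (hc : 0 < c) :
    IsClosed {ω : Fin N → EuclideanSpace ℝ (Fin (d + 1)) |
      c ≤ maxFacetVol (d + 1) (convexHull ℝ (Set.range ω))} := by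
  have := hausdorffMeasure_isAddHaar d
  let S := sphere (0 : EuclideanSpace ℝ (Fin (d + 1))) 1
  let B := closedBall (0 : EuclideanSpace ℝ (Fin (d + 1)) →L[ℝ] EuclideanSpace ℝ (Fin d)) 1
  have : CompactSpace B := isCompact_iff_compactSpace.1 (isCompact_closedBall _ _)
  let T : Set (Fin N) → Set ((Fin N → EuclideanSpace ℝ (Fin (d + 1))) × (S × B)) := fun I =>
    {p | (∀ i ∈ I, ∀ j, inner ℝ (p.2.1 : EuclideanSpace ℝ (Fin (d + 1))) (p.1 j) ≤
        inner ℝ (p.2.1 : EuclideanSpace ℝ (Fin (d + 1))) (p.1 i)) ∧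
      ENNReal.ofReal c ≤ μH[(d : ℝ)] (convexHull ℝ (Set.range fun i : I => p.2.2.1 (p.1 i)))}
  have hT : ∀ I, IsClosed (T I) := by
    intro I
    have h1 : IsClosed {p : (Fin N → EuclideanSpace ℝ (Fin (d + 1))) × (S × B) | ∀ i ∈ I, ∀ j,
        inner ℝ (p.2.1 : EuclideanSpace ℝ (Fin (d + 1))) (p.1 j) ≤
          inner ℝ (p.2.1 : EuclideanSpace ℝ (Fin (d + 1))) (p.1 i)} := by
      simp only [Set.ofPred_forall]
      refine isClosed_iInter fun i => isClosed_iInter fun _ => isClosed_iInter fun j => ?_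
      exact isClosed_le (by fun_prop) (by fun_prop)
    refine h1.inter ?_
    refine (isClosed_le_measure_convexHull (κ := I) (μH[(d : ℝ)] :
      Measure (EuclideanSpace ℝ (Fin d))) (ENNReal.ofReal c)).preimage
      (f := fun (p : (Fin N → EuclideanSpace ℝ (Fin (d + 1))) × (S × B)) (i : I) =>
        p.2.2.1 (p.1 i)) ?_
    fun_prop
  have heq : {ω : Fin N → EuclideanSpace ℝ (Fin (d + 1)) |
      c ≤ maxFacetVol (d + 1) (convexHull ℝ (Set.range ω))} = ⋃ I, Prod.fst '' T I := by
    ext ω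
    simp only [Set.mem_ofPred_eq, Set.mem_iUnion]
    constructor
    · intro h
      obtain ⟨F, hF, hcF⟩ := exists_facet_of_le_maxFacetVol hc h
      have hne : F.Nonempty := by
        by_contra hne
        rw [Set.not_nonempty_iff_eq_empty.1 hne] at hcF
        simp only [measure_empty, ENNReal.toReal_zero] at hcF
        exact hc.not_ge hcF
      obtain ⟨ν, hν, A, hA, hsup, hvol⟩ := hF.exists_support hne
      refine ⟨{i | ω i ∈ F}, ⟨ω, ⟨ν, by simpa [S] using hν⟩, ⟨A, by simpa [B] using hA⟩⟩,
        ⟨hsup, ?_⟩, rfl⟩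
      simp only
      rw [hvol]
      exact ENNReal.ofReal_le_of_le_toReal hcF
    · rintro ⟨I, ⟨ω', ⟨ν, hν⟩, ⟨A, hA⟩⟩, ⟨hsup, hvol⟩, rfl⟩
      have hν0 : ν ≠ 0 := by
        rintro rfl
        simp [S] at hν
      refine le_trans ?_ (le_maxFacetVol_of_support ω' hν0 hsup (by simpa [B] using hA)
        (lt_of_lt_of_le (by simpa using hc) hvol))
      refine (ENNReal.ofReal_le_iff_le_toReal ?_).1 hvol
      exact ((Set.finite_range _).isCompact_convexHull ℝ).measure_lt_top.ne
  rw [heq]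
  exact isClosed_iUnion_of_finite fun I => isClosedMap_fst_of_compactSpace _ (hT I)

lemma measurable_maxFacetVol (d N : ℕ) :
    Measurable fun ω : Fin N → EuclideanSpace ℝ (Fin (d + 1)) =>
      maxFacetVol (d + 1) (convexHull ℝ (Set.range ω)) := by
  refine measurable_of_Ici fun c => ?_
  rcases le_or_gt c 0 with hc | hc
  · convert MeasurableSet.univ
    ext ω
    simpa using hc.trans (maxFacetVol_nonneg _ _)
  · exact (isClosed_le_maxFacetVol hc).measurableSet

lemma ae_pi_of_ae {Ω : Type*} [MeasurableSpace Ω] {σ : Measure Ω} [IsProbabilityMeasure σ]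
    (κ : Type*) [Fintype κ] {p : Ω → Prop} (h : ∀ᵐ x ∂σ, p x) :
    ∀ᵐ ω ∂(Measure.pi fun _ : κ => σ), ∀ i, p (ω i) := by
  rw [ae_all_iff]
  exact fun i => (Measure.quasiMeasurePreserving_eval (fun _ : κ => σ) i).ae h

lemma integrable_maxFacetVol (d N : ℕ) :
    Integrable (fun ω : Fin N → EuclideanSpace ℝ (Fin (d + 1)) =>
      maxFacetVol (d + 1) (convexHull ℝ (Set.range ω)))
      (Measure.pi fun _ : Fin N => sphereUniform (d + 1)) := by
  refine Integrable.of_bound (measurable_maxFacetVol d N).aestronglyMeasurable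
    (μH[(d : ℝ)] (closedBall (0 : EuclideanSpace ℝ (Fin d)) 1)).toReal ?_
  have h := ae_pi_of_ae (Fin N) (ae_mem_sphere d)
  filter_upwards [h] with ω hω
  rw [Real.norm_of_nonneg (maxFacetVol_nonneg _ _)]
  refine maxFacetVol_le (convexHull_min ?_ (convex_closedBall _ _))
  rintro _ ⟨i, rfl⟩
  simp [hω i]

/-- A configuration whose convex hull has positive measure spans the whole space. -/
lemma affineSpan_eq_top_of_measure_pos {E : Type*} [NormedAddCommGroup E]
    [NormedSpace ℝ E] [FiniteDimensional ℝ E] [MeasurableSpace E] [BorelSpace E]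
    (μ : Measure E) [μ.IsAddHaarMeasure] {s : Set E} (h : 0 < μ (convexHull ℝ s)) :
    affineSpan ℝ s = ⊤ := by
  by_contra hs
  exact h.ne' (measure_mono_null (convexHull_subset_affineSpan s)
    (Measure.addHaar_affineSubspace μ _ hs))

/-- Near a nondegenerate simplex the measure of the convex hull cannot drop much. -/
lemma exists_half_measure_convexHull_le {d : ℕ} (μ : Measure (EuclideanSpace ℝ (Fin d)))
    [μ.IsAddHaarMeasure] (z : Fin (d + 1) → EuclideanSpace ℝ (Fin d))
    (hz : 0 < μ (convexHull ℝ (Set.range z))) :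
    ∃ ε > 0, ∀ w : Fin (d + 1) → EuclideanSpace ℝ (Fin d), (∀ k, ‖w k - z k‖ ≤ ε) →
      2⁻¹ * μ (convexHull ℝ (Set.range z)) ≤ μ (convexHull ℝ (Set.range w)) := by
  have htop := affineSpan_eq_top_of_measure_pos μ hz
  have hind : AffineIndependent ℝ z := by
    rw [affineIndependent_iff_le_finrank_vectorSpan ℝ z (n := d) (by simp),
      AffineSubspace.vectorSpan_eq_top_of_affineSpan_eq_top _ _ _ htop]
    simp
  let b : AffineBasis (Fin (d + 1)) ℝ (EuclideanSpace ℝ (Fin d)) := ⟨z, hind, htop⟩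
  have hb : ∀ k, b k = z k := fun _ => rfl
  let C : ℝ := ∑ k, ‖(LinearMap.toContinuousLinearMap (b.coord k).linear)‖
  have hC : 0 ≤ C := Finset.sum_nonneg fun _ _ => norm_nonneg _
  have hdet : ((2⁻¹ : ℝ≥0) : ℝ≥0∞) <
      ENNReal.ofReal |(ContinuousLinearMap.id ℝ (EuclideanSpace ℝ (Fin d))).det| := by
    simp [ContinuousLinearMap.det, ENNReal.inv_lt_one]
  obtain ⟨δ, hδ, hδ0⟩ :=
    ((mul_le_addHaar_image_of_lt_det μ (ContinuousLinearMap.id ℝ _) hdet).and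
      self_mem_nhdsWithin).exists
  have hδ0' : (0 : ℝ) < δ := hδ0
  refine ⟨δ / (C + 1), by positivity, fun w hw => ?_⟩
  let f : EuclideanSpace ℝ (Fin d) →ᵃ[ℝ] EuclideanSpace ℝ (Fin d) :=
    { toFun := fun x => ∑ k, b.coord k x • w k
      linear := ∑ k, (b.coord k).linear.smulRight (w k)
      map_vadd' := fun p v => by
        have h : ∀ k, b.coord k (v +ᵥ p) = (b.coord k).linear v + b.coord k p :=
          fun k => (b.coord k).map_vadd p v
        simp only [h, add_smul, Finset.sum_add_distrib, LinearMap.sum_apply,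
          LinearMap.smulRight_apply, vadd_eq_add (a := ∑ k, (b.coord k).linear v • w k)] }
  have hf : ∀ x, f x = ∑ k, b.coord k x • w k := fun x => rfl
  have hfz : ∀ j, f (z j) = w j := fun j => by
    rw [hf, ← hb]
    simp [AffineBasis.coord_apply]
  have himg : f '' convexHull ℝ (Set.range z) = convexHull ℝ (Set.range w) := by
    rw [AffineMap.image_convexHull, ← Set.range_comp]
    congr 2
    exact funext hfz
  have happ : ApproximatesLinearOn f (ContinuousLinearMap.id ℝ _)
      (convexHull ℝ (Set.range z)) δ := by
    intro x _ y _
    have hx := b.linear_combination_coord_eq_self x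
    have hy := b.linear_combination_coord_eq_self y
    have hxy : f x - f y - (ContinuousLinearMap.id ℝ _) (x - y) =
        ∑ k, (b.coord k).linear (x - y) • (w k - z k) := by
      have hsub : x - y = ∑ k, (b.coord k x - b.coord k y) • z k := by
        simp only [sub_smul, Finset.sum_sub_distrib, ← hb]
        rw [hx, hy]
      rw [ContinuousLinearMap.id_apply, hf, hf, ← Finset.sum_sub_distrib]
      conv_lhs => rw [hsub]
      rw [← Finset.sum_sub_distrib]
      refine Finset.sum_congr rfl fun k _ => ?_
      have := (b.coord k).linearMap_vsub x y
      rw [vsub_eq_sub, vsub_eq_sub] at this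
      rw [this]
      module
    rw [hxy]
    refine (norm_sum_le _ _).trans ?_
    calc ∑ k, ‖(b.coord k).linear (x - y) • (w k - z k)‖
        ≤ ∑ k, (‖(LinearMap.toContinuousLinearMap (b.coord k).linear)‖ * ‖x - y‖) *
            (δ / (C + 1)) := by
          refine Finset.sum_le_sum fun k _ => ?_
          rw [norm_smul]
          gcongr
          · exact (LinearMap.toContinuousLinearMap (b.coord k).linear).le_opNorm (x - y)
          · exact hw k
      _ = C * ‖x - y‖ * (δ / (C + 1)) := by
          rw [← Finset.sum_mul, ← Finset.sum_mul]
      _ = (C / (C + 1)) * (δ * ‖x - y‖) := by ring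
      _ ≤ δ * ‖x - y‖ := by
          refine mul_le_of_le_one_left (by positivity) ?_
          rw [div_le_one (by positivity)]
          linarith
  have := hδ _ _ happ
  rw [himg] at this
  simpa using this

/-- Near a nondegenerate simplex, the linear system for the circumscribed sphere is solvable with
control on the solution. -/
lemma exists_circumscribed {d : ℕ} (z : Fin (d + 1) → EuclideanSpace ℝ (Fin d))
    (hz : affineSpan ℝ (Set.range z) = ⊤) :
    ∃ ε > 0, ∀ w : Fin (d + 1) → EuclideanSpace ℝ (Fin d), (∀ k, ‖w k - z k‖ ≤ ε) →
      ∀ m : Fin (d + 1) → ℝ, (∀ k, |m k - 1 / 8| ≤ ε) →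
        ∃ (β : EuclideanSpace ℝ (Fin d)) (τ : ℝ), (∀ k, inner ℝ (w k) β + τ = m k) ∧
          ‖β‖ ≤ 1 / 16 ∧ |τ - 1 / 8| ≤ 1 / 16 := by
  let Φ : (Fin (d + 1) → EuclideanSpace ℝ (Fin d)) →
      (EuclideanSpace ℝ (Fin d) × ℝ) →ₗ[ℝ] (Fin (d + 1) → ℝ) := fun w =>
    LinearMap.pi fun k => (innerSL ℝ (w k)).toLinearMap ∘ₗ LinearMap.fst ℝ _ _ +
      LinearMap.snd ℝ _ _
  have hΦ : ∀ w x k, Φ w x k = inner ℝ (w k) x.1 + x.2 := fun w x k => by simp [Φ]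
  have hker : LinearMap.ker (Φ z) = ⊥ := by
    rw [LinearMap.ker_eq_bot']
    rintro ⟨β, τ⟩ h
    have h' : ∀ k, inner ℝ (z k) β + τ = 0 := fun k => by
      rw [← hΦ z (β, τ) k, h]; rfl
    have hle : vectorSpan ℝ (Set.range z) ≤ (Submodule.span ℝ {β})ᗮ := by
      refine Submodule.span_le.2 ?_
      rintro _ ⟨_, ⟨i, rfl⟩, _, ⟨j, rfl⟩, rfl⟩
      rw [SetLike.mem_coe, Submodule.mem_orthogonal_singleton_iff_inner_left]
      change inner ℝ (z i - z j) β = 0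
      rw [inner_sub_left]
      linarith [h' i, h' j]
    rw [AffineSubspace.vectorSpan_eq_top_of_affineSpan_eq_top _ _ _ hz] at hle
    have hβ : inner ℝ β β = (0 : ℝ) :=
      Submodule.mem_orthogonal_singleton_iff_inner_left.1 (hle (Submodule.mem_top (x := β)))
    have hβ0 : β = 0 := inner_self_eq_zero.1 hβ
    have := h' 0
    simp only [hβ0, inner_zero_right, zero_add] at this
    simp [hβ0, this]
  obtain ⟨K, hK0, hK⟩ := (Φ z).exists_antilipschitzWith hker
  have hK0' : (0 : ℝ) < K := hK0
  have hKz : ∀ x, ‖x‖ ≤ K * ‖Φ z x‖ := fun x => by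
    have := hK.le_mul_dist x 0
    simpa using this
  refine ⟨1 / (32 * K), by positivity, fun w hw m hm => ?_⟩
  have hKw : ∀ x, ‖x‖ ≤ 2 * K * ‖Φ w x‖ := by
    intro x
    have h1 : ‖Φ z x - Φ w x‖ ≤ 1 / (32 * K) * ‖x‖ := by
      refine (pi_norm_le_iff_of_nonneg (by positivity)).2 fun k => ?_
      rw [Pi.sub_apply, hΦ, hΦ, add_sub_add_right_eq_sub, ← inner_sub_left]
      refine (norm_inner_le_norm _ _).trans ?_
      gcongr
      · rw [norm_sub_rev]; exact hw k
      · exact norm_fst_le x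
    have h2 : ‖Φ z x‖ ≤ ‖Φ w x‖ + 1 / (32 * K) * ‖x‖ := by
      have := norm_le_norm_add_norm_sub (Φ w x) (Φ z x)
      rw [norm_sub_rev] at this
      linarith
    have h3 : K * ‖Φ z x‖ ≤ K * ‖Φ w x‖ + 1 / 32 * ‖x‖ := by
      calc K * ‖Φ z x‖ ≤ K * (‖Φ w x‖ + 1 / (32 * K) * ‖x‖) := by gcongr
        _ = K * ‖Φ w x‖ + 1 / 32 * ‖x‖ := by field_simp
    have := hKz x
    nlinarith [norm_nonneg x]
  have hinj : Function.Injective (Φ w) := by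
    rw [← LinearMap.ker_eq_bot, LinearMap.ker_eq_bot']
    intro x hx
    have := hKw x
    rw [hx, norm_zero, mul_zero] at this
    exact norm_le_zero_iff.1 this
  have hsurj := (LinearMap.injective_iff_surjective_of_finrank_eq_finrank (by simp)).1 hinj
  obtain ⟨x, hx⟩ := hsurj (fun k => m k - 1 / 8)
  have hxn : ‖x‖ ≤ 1 / 16 := by
    refine (hKw x).trans ?_
    have : ‖Φ w x‖ ≤ 1 / (32 * K) := by
      rw [hx]
      exact (pi_norm_le_iff_of_nonneg (by positivity)).2 hm
    calc 2 * K * ‖Φ w x‖ ≤ 2 * K * (1 / (32 * K)) := by gcongr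
      _ = 1 / 16 := by field_simp; norm_num
  refine ⟨x.1, x.2 + 1 / 8, fun k => ?_, (norm_fst_le x).trans hxn, ?_⟩
  · have := congrFun hx k
    rw [hΦ] at this
    linarith
  · rw [add_sub_cancel_right]
    exact (norm_snd_le x).trans hxn

/-- The height of a point of the sphere in a direction close to `u`. -/
lemma inner_frame_of_mem_sphere {d : ℕ} {u : EuclideanSpace ℝ (Fin (d + 1))} (hu : ‖u‖ = 1)
    {A : EuclideanSpace ℝ (Fin (d + 1)) →L[ℝ] EuclideanSpace ℝ (Fin d)}
    {ι : EuclideanSpace ℝ (Fin d) →ₗ[ℝ] EuclideanSpace ℝ (Fin (d + 1))}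
    (hadj : ∀ x w, inner ℝ x (ι w) = inner ℝ (A x) w)
    {y : EuclideanSpace ℝ (Fin (d + 1))} (hy : ‖y‖ = 1) (c : ℝ)
    (β : EuclideanSpace ℝ (Fin d)) :
    inner ℝ (u + c • ι β) y = 1 - ‖y - u‖ ^ 2 / 2 + c * inner ℝ (A y) β := by
  have h1 : ‖y - u‖ ^ 2 = 2 - 2 * inner ℝ u y := by
    rw [norm_sub_sq_real, hu, hy, real_inner_comm]; ring
  rw [inner_add_left, real_inner_smul_left, real_inner_comm y (ι β), hadj, h1]
  ring

lemma norm_sq_frame_of_mem_sphere {d : ℕ} {u : EuclideanSpace ℝ (Fin (d + 1))} (hu : ‖u‖ = 1)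
    {A : EuclideanSpace ℝ (Fin (d + 1)) →L[ℝ] EuclideanSpace ℝ (Fin d)}
    (hA : ∀ x, ‖x‖ ^ 2 = inner ℝ u x ^ 2 + ‖A x‖ ^ 2)
    {y : EuclideanSpace ℝ (Fin (d + 1))} (hy : ‖y‖ = 1) :
    ‖y - u‖ ^ 2 = ‖A y‖ ^ 2 + ‖y - u‖ ^ 4 / 4 := by
  have h1 : ‖y - u‖ ^ 2 = 2 - 2 * inner ℝ u y := by
    rw [norm_sub_sq_real, hu, hy, real_inner_comm]; ring
  have h2 := hA y
  rw [hy] at h2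
  have h3 : ‖y - u‖ ^ 4 = (‖y - u‖ ^ 2) ^ 2 := by ring
  rw [h3, h1]
  nlinarith

/-- Around every point of the sphere there is a configuration of small caps such that, if each
of them contains one of the given points and the remaining points avoid a larger cap, then the
convex hull has a large facet. -/
lemma exists_facet_configuration {d : ℕ} (ζ : Fin (d + 1) → EuclideanSpace ℝ (Fin d))
    (hζ : ∀ k, ‖ζ k‖ = 1) (hpos : 0 < μH[(d : ℝ)] (convexHull ℝ (Set.range ζ))) :
    ∃ ε > 0, ε ≤ 1 ∧ ∃ r₀ > 0, ∀ r, 0 < r → r ≤ r₀ →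
      ∀ u : EuclideanSpace ℝ (Fin (d + 1)), ‖u‖ = 1 →
      ∃ x : Fin (d + 1) → EuclideanSpace ℝ (Fin (d + 1)), (∀ k, ‖x k‖ = 1) ∧
        (∀ k, ball (x k) (ε * r) ⊆ ball u r) ∧
        (Pairwise fun k l => Disjoint (ball (x k) (ε * r)) (ball (x l) (ε * r))) ∧
        ∀ (N : ℕ) (ω : Fin N → EuclideanSpace ℝ (Fin (d + 1))), (∀ j, ‖ω j‖ = 1) →
          ∀ f : Fin (d + 1) → Fin N, (∀ k, ω (f k) ∈ ball (x k) (ε * r)) →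
            (∀ j ∉ Set.range f, ω j ∉ ball u r) →
            r ^ d * (1 / 2) ^ (d + 1) * (μH[(d : ℝ)] (convexHull ℝ (Set.range ζ))).toReal ≤
              maxFacetVol (d + 1) (convexHull ℝ (Set.range ω)) := by
  have := hausdorffMeasure_isAddHaar d
  set μ : Measure (EuclideanSpace ℝ (Fin d)) := μH[(d : ℝ)] with hμ
  set z : Fin (d + 1) → EuclideanSpace ℝ (Fin d) := fun k => (1 / 2 : ℝ) • ζ k with hz
  have hsmul : ∀ (c : ℝ), 0 ≤ c → ∀ v : Fin (d + 1) → EuclideanSpace ℝ (Fin d),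
      μ (convexHull ℝ (Set.range fun k => c • v k)) =
        ENNReal.ofReal (c ^ d) * μ (convexHull ℝ (Set.range v)) := by
    intro c hc v
    have : (Set.range fun k => c • v k) = c • Set.range v := by
      rw [Set.smul_set_range]
    rw [this, convexHull_smul, Measure.addHaar_smul, finrank_euclideanSpace_fin,
      abs_of_nonneg (by positivity)]
  have hzn : ∀ k, ‖z k‖ = 1 / 2 := fun k => by
    simp [hz, norm_smul, hζ]
  have hzvol := hsmul (1 / 2) (by norm_num) ζ
  have hzpos : 0 < μ (convexHull ℝ (Set.range z)) := by
    rw [hzvol]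
    exact ENNReal.mul_pos (by simp) hpos.ne'
  obtain ⟨ε₁, hε₁, hvol⟩ := exists_half_measure_convexHull_le μ z hzpos
  obtain ⟨ε₂, hε₂, hcirc⟩ := exists_circumscribed z (affineSpan_eq_top_of_measure_pos μ hzpos)
  have hdist : ∀ k l, k ≠ l → ε₂ < ‖z k - z l‖ := by
    intro k l hkl
    by_contra! h
    obtain ⟨β, τ, h1, -⟩ := hcirc (Function.update z k (z l)) (fun j => by
      by_cases hj : j = k
      · subst hj; rw [Function.update_self, norm_sub_rev]; exact h
      · rw [Function.update_of_ne hj]; simpa using hε₂.le)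
      (Function.update (fun _ => 1 / 8) k (1 / 8 + ε₂)) (fun j => by
      by_cases hj : j = k
      · subst hj; rw [Function.update_self]; simp [abs_of_pos hε₂]
      · rw [Function.update_of_ne hj]; simpa using hε₂.le)
    have hk := h1 k
    have hl := h1 l
    rw [Function.update_self, Function.update_self] at hk
    rw [Function.update_of_ne hkl.symm, Function.update_of_ne hkl.symm] at hl
    linarith
  set ε := min (min (ε₁ / 2) (ε₂ / 2)) (1 / 8) with hε
  have hε0 : 0 < ε := by positivity
  have hεa : ε ≤ ε₁ / 2 := (min_le_left _ _).trans (min_le_left _ _)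
  have hεb : ε ≤ ε₂ / 2 := (min_le_left _ _).trans (min_le_right _ _)
  have hεc : ε ≤ 1 / 8 := min_le_right _ _
  refine ⟨ε, hε0, by linarith, min 1 ε₂, by positivity, fun r hr hr₀ u hu => ?_⟩
  have hr1 : r ≤ 1 := hr₀.trans (min_le_left _ _)
  have hr2 : r ≤ ε₂ := hr₀.trans (min_le_right _ _)
  obtain ⟨A, ι, hA1, hA, hι, hu', hadj⟩ := exists_hyperplane_frame u hu
  have hAle : ∀ y, ‖A y‖ ≤ ‖y‖ := fun y =>
    (A.le_opNorm y).trans (mul_le_of_le_one_left (norm_nonneg _) hA1)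
  have hx : ∀ k, ∃ x ∈ sphere (0 : EuclideanSpace ℝ (Fin (d + 1))) 1, A x = r • z k ∧
      ‖x - u‖ ^ 2 ≤ 2 * ‖r • z k‖ ^ 2 := fun k =>
    exists_mem_sphere_over hu hA hι hu' (by
      rw [norm_smul, hzn, Real.norm_of_nonneg hr.le]; linarith)
  choose x hxs hxA hxu using hx
  have hxu' : ∀ k, ‖x k - u‖ ≤ 3 / 4 * r := fun k => by
    have := hxu k
    rw [norm_smul, hzn, Real.norm_of_nonneg hr.le] at this
    refine abs_le_of_sq_le_sq' ?_ (by positivity) |>.2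
    nlinarith
  have hsub : ∀ k, ball (x k) (ε * r) ⊆ ball u r := fun k => by
    refine ball_subset_ball' ?_
    rw [dist_eq_norm]
    nlinarith [hxu' k]
  refine ⟨x, fun k => by simpa using hxs k, hsub, ?_, ?_⟩
  · intro k l hkl
    refine ball_disjoint_ball ?_
    rw [dist_eq_norm]
    refine le_trans ?_ (hAle _)
    rw [map_sub, hxA, hxA, ← smul_sub, norm_smul, Real.norm_of_nonneg hr.le]
    nlinarith [hdist k l hkl]
  intro N ω hω f hf hout
  set w : Fin (d + 1) → EuclideanSpace ℝ (Fin d) := fun k => r⁻¹ • A (ω (f k)) with hw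
  have hrw : ∀ k, A (ω (f k)) = r • w k := fun k => by
    rw [hw, smul_inv_smul₀ hr.ne']
  have hwz : ∀ k, ‖w k - z k‖ ≤ ε := fun k => by
    have h1 : r • (w k - z k) = A (ω (f k) - x k) := by
      rw [smul_sub, ← hrw, ← hxA, map_sub]
    have h2 : r * ‖w k - z k‖ ≤ ε * r := by
      have h3 : ‖r • (w k - z k)‖ = r * ‖w k - z k‖ := by
        rw [norm_smul, Real.norm_of_nonneg hr.le]
      rw [← h3, h1]
      refine (hAle _).trans ?_
      have := hf k
      rw [mem_ball, dist_eq_norm] at this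
      exact this.le
    nlinarith
  set q : Fin (d + 1) → ℝ := fun k => ‖ω (f k) - u‖ / r with hq
  have hqr : ∀ k, ‖ω (f k) - u‖ = r * q k := fun k => by rw [hq]; field_simp
  have hq0 : ∀ k, 0 ≤ q k := fun k => by positivity
  have hq1 : ∀ k, q k ≤ 1 := fun k => by
    have := hsub k (hf k)
    rw [mem_ball, dist_eq_norm, hqr] at this
    nlinarith
  have hm : ∀ k, |q k ^ 2 / 2 - 1 / 8| ≤ ε₂ := fun k => by
    have h1 := norm_sq_frame_of_mem_sphere hu hA (hω (f k))
    rw [hrw, norm_smul, Real.norm_of_nonneg hr.le, hqr] at h1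
    have h2 : q k ^ 2 = ‖w k‖ ^ 2 + r ^ 2 * q k ^ 4 / 4 := by
      have : r ^ 2 * q k ^ 2 = r ^ 2 * (‖w k‖ ^ 2 + r ^ 2 * q k ^ 4 / 4) := by
        linear_combination h1
      exact mul_left_cancel₀ (by positivity) this
    have h3 : |‖w k‖ - 1 / 2| ≤ ε := by
      rw [← hzn k]
      exact (abs_norm_sub_norm_le _ _).trans (hwz k)
    have h4 : q k ^ 4 ≤ 1 := pow_le_one₀ (hq0 k) (hq1 k)
    have h5 : 0 ≤ r ^ 2 * q k ^ 4 := by positivity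
    have h6 : r ^ 2 * q k ^ 4 ≤ ε₂ := by
      calc r ^ 2 * q k ^ 4 ≤ r ^ 2 * 1 := by gcongr
        _ ≤ ε₂ := by nlinarith
    rw [abs_le] at h3 ⊢
    constructor <;> nlinarith
  obtain ⟨β, τ, hβτ, hβ, hτ⟩ := hcirc w (fun k => (hwz k).trans (by linarith))
    (fun k => q k ^ 2 / 2) hm
  rw [abs_le] at hτ
  set ν := u + r • ι β with hν
  have hν0 : ν ≠ 0 := by
    intro h
    have h1 : inner ℝ u ν = (1 : ℝ) := by
      rw [hν, inner_add_right, real_inner_smul_right, hu', real_inner_self_eq_norm_sq, hu]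
      norm_num
    rw [h, inner_zero_right] at h1
    norm_num at h1
  have hin : ∀ k, inner ℝ ν (ω (f k)) = 1 - r ^ 2 * τ := fun k => by
    rw [hν, inner_frame_of_mem_sphere hu hadj (hω _), hrw, real_inner_smul_left, hqr]
    linear_combination r ^ 2 * hβτ k
  have hAu : A u = 0 := by
    have := hA u
    rw [real_inner_self_eq_norm_sq, hu] at this
    have h0 : ‖A u‖ ^ 2 = 0 := by linarith
    simpa using h0
  have hle : ∀ j, inner ℝ ν (ω j) ≤ 1 - r ^ 2 * τ := fun j => by
    by_cases hj : j ∈ Set.range f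
    · obtain ⟨k, rfl⟩ := hj
      exact (hin k).le
    · have hjo := hout j hj
      rw [mem_ball, dist_eq_norm, not_lt] at hjo
      rw [hν, inner_frame_of_mem_sphere hu hadj (hω _)]
      have h1 : inner ℝ (A (ω j)) β ≤ ‖ω j - u‖ * (1 / 16) := by
        calc inner ℝ (A (ω j)) β = inner ℝ (A (ω j - u)) β := by rw [map_sub, hAu, sub_zero]
          _ ≤ ‖A (ω j - u)‖ * ‖β‖ := real_inner_le_norm _ _
          _ ≤ ‖ω j - u‖ * (1 / 16) := by
            gcongr
            exact hAle _
      have h2 : r * inner ℝ (A (ω j)) β ≤ r * (‖ω j - u‖ * (1 / 16)) := by gcongr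
      nlinarith
  have hrange : (Set.range fun i : Set.range f => A (ω i)) = Set.range fun k => r • w k := by
    ext y
    simp only [Set.mem_range, Subtype.exists]
    constructor
    · rintro ⟨_, ⟨k, rfl⟩, rfl⟩
      exact ⟨k, (hrw k).symm⟩
    · rintro ⟨k, rfl⟩
      exact ⟨f k, ⟨k, rfl⟩, hrw k⟩
  have hfin : μ (convexHull ℝ (Set.range ζ)) ≠ ∞ :=
    ((Set.finite_range _).isCompact_convexHull ℝ).measure_lt_top.ne
  have hfin' : μ (convexHull ℝ (Set.range fun k => r • w k)) ≠ ∞ :=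
    ((Set.finite_range _).isCompact_convexHull ℝ).measure_lt_top.ne
  have hlow : ENNReal.ofReal (r ^ d * (1 / 2) ^ (d + 1)) * μ (convexHull ℝ (Set.range ζ)) ≤
      μ (convexHull ℝ (Set.range fun k => r • w k)) := by
    rw [hsmul r hr.le]
    calc ENNReal.ofReal (r ^ d * (1 / 2) ^ (d + 1)) * μ (convexHull ℝ (Set.range ζ))
        = ENNReal.ofReal (r ^ d) * (2⁻¹ * μ (convexHull ℝ (Set.range z))) := by
          rw [hzvol, pow_succ, ← mul_assoc, mul_comm _ (1 / 2 : ℝ), ENNReal.ofReal_mul (by simp),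
            ENNReal.ofReal_mul (by positivity), one_div, ENNReal.ofReal_inv_of_pos two_pos]
          simp only [ENNReal.ofReal_ofNat]
          ring
      _ ≤ _ := by
          gcongr
          exact hvol w fun k => (hwz k).trans (by linarith)
  have hmain := le_maxFacetVol_of_support ω hν0 (I := Set.range f)
    (by rintro _ ⟨k, rfl⟩ j; rw [hin]; exact hle j) hA1
    (by
      rw [hrange]
      exact lt_of_lt_of_le (ENNReal.mul_pos (by simp; positivity) hpos.ne') hlow)
  rw [hrange] at hmain
  refine le_trans ?_ hmain
  have := ENNReal.toReal_mono hfin' hlow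
  rwa [ENNReal.toReal_mul, ENNReal.toReal_ofReal (by positivity)] at this

/-- A second moment bound for the probability of a finite union. -/
lemma second_moment_le_measureReal_iUnion {Ω T : Type*} [MeasurableSpace Ω] [Fintype T]
    (P : Measure Ω) [IsProbabilityMeasure P] {E : T → Set Ω} (hE : ∀ t, MeasurableSet (E t))
    {K : ℝ} (hK : 0 ≤ K)
    (h : ∀ t t', t ≠ t' → P.real (E t ∩ E t') ≤ K * (P.real (E t) * P.real (E t')))
    (hm : 0 < ∑ t, P.real (E t)) :
    2 - 1 / (∑ t, P.real (E t)) - K ≤ P.real (⋃ t, E t) := by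
  classical
  set m := ∑ t, P.real (E t) with hmdef
  set X : Ω → ℝ := fun ω => ∑ t, (E t).indicator 1 ω with hX
  have hind : ∀ s : Set Ω, MeasurableSet s → Integrable (s.indicator (1 : Ω → ℝ)) P :=
    fun s hs => (integrable_const (1 : ℝ)).indicator hs
  have hXi : Integrable X P := integrable_finsetSum _ fun t _ => hind _ (hE t)
  have hEX : ∫ ω, X ω ∂P = m := by
    rw [integral_finsetSum _ fun t _ => hind _ (hE t)]
    exact Finset.sum_congr rfl fun t _ => integral_indicator_one (hE t)
  have hX2 : ∀ ω, X ω ^ 2 = ∑ t, ∑ t', (E t ∩ E t').indicator (1 : Ω → ℝ) ω := fun ω => by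
    rw [hX, sq, Finset.sum_mul_sum]
    refine Finset.sum_congr rfl fun t _ => Finset.sum_congr rfl fun t' _ => ?_
    rw [Set.inter_indicator_one]; rfl
  have hX2i : Integrable (fun ω => X ω ^ 2) P := by
    simp only [hX2]
    exact integrable_finsetSum _ fun t _ => integrable_finsetSum _ fun t' _ =>
      hind _ ((hE t).inter (hE t'))
  have hEX2 : ∫ ω, X ω ^ 2 ∂P ≤ m + K * m ^ 2 := by
    simp only [hX2]
    rw [integral_finsetSum _ fun t _ => integrable_finsetSum _ fun t' _ =>
      hind _ ((hE t).inter (hE t'))]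
    have : ∀ t, ∫ ω, ∑ t', (E t ∩ E t').indicator (1 : Ω → ℝ) ω ∂P =
        ∑ t', P.real (E t ∩ E t') := fun t => by
      rw [integral_finsetSum _ fun t' _ => hind _ ((hE t).inter (hE t'))]
      exact Finset.sum_congr rfl fun t' _ => integral_indicator_one ((hE t).inter (hE t'))
    simp only [this]
    calc ∑ t, ∑ t', P.real (E t ∩ E t')
        ≤ ∑ t, ∑ t', ((if t = t' then P.real (E t) else 0) +
            K * (P.real (E t) * P.real (E t'))) := by
          refine Finset.sum_le_sum fun t _ => Finset.sum_le_sum fun t' _ => ?_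
          by_cases htt : t = t'
          · subst htt
            rw [if_pos rfl, Set.inter_self]
            have : 0 ≤ K * (P.real (E t) * P.real (E t)) := by positivity
            linarith
          · rw [if_neg htt, zero_add]
            exact h t t' htt
      _ = m + K * m ^ 2 := by
          simp only [Finset.sum_add_distrib, Finset.sum_ite_eq, Finset.mem_univ, if_true]
          rw [hmdef, sq, Finset.sum_mul_sum]
          simp only [Finset.mul_sum]
  have hG : MeasurableSet (⋃ t, E t) := MeasurableSet.iUnion hE
  have hpt : ∀ ω, 2 / m * X ω - 1 / m ^ 2 * X ω ^ 2 ≤ (⋃ t, E t).indicator 1 ω := fun ω => by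
    by_cases hω : ω ∈ ⋃ t, E t
    · rw [Set.indicator_of_mem hω, Pi.one_apply]
      have : 2 / m * X ω - 1 / m ^ 2 * X ω ^ 2 = 1 - (1 - X ω / m) ^ 2 := by
        field_simp; ring
      rw [this]
      nlinarith [sq_nonneg (1 - X ω / m)]
    · have hX0 : X ω = 0 := Finset.sum_eq_zero fun t _ =>
        Set.indicator_of_notMem (fun ht => hω (Set.mem_iUnion.2 ⟨t, ht⟩)) _
      rw [Set.indicator_of_notMem hω, hX0]
      simp
  have hint := integral_mono ((hXi.const_mul (2 / m)).sub (hX2i.const_mul (1 / m ^ 2)))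
    (hind _ hG) hpt
  rw [integral_indicator_one hG, integral_sub' (hXi.const_mul _) (hX2i.const_mul _),
    integral_const_mul, integral_const_mul, hEX] at hint
  refine le_trans ?_ hint
  have h1 : 1 / m ^ 2 * ∫ ω, X ω ^ 2 ∂P ≤ 1 / m ^ 2 * (m + K * m ^ 2) := by gcongr
  have h2 : 1 / m ^ 2 * (m + K * m ^ 2) = 1 / m + K := by field_simp
  have h3 : 2 / m * m = 2 := by field_simp
  linarith

/-- The event that the sample points with labels `f k` lie in `A k`, while all others avoid `C`. -/
def occupationSet {α : Type*} {n N : ℕ} (C : Set α) (A : Fin n → Set α) (f : Fin n ↪ Fin N) :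
    Set (Fin N → α) :=
  Set.univ.pi (Function.extend f A fun _ => Cᶜ)

lemma mem_occupationSet {α : Type*} {n N : ℕ} {C : Set α} {A : Fin n → Set α}
    {f : Fin n ↪ Fin N} {ω : Fin N → α} (h : ω ∈ occupationSet C A f) :
    (∀ k, ω (f k) ∈ A k) ∧ ∀ j ∉ Set.range f, ω j ∉ C := by
  refine ⟨fun k => ?_, fun j hj => ?_⟩
  · have := h (f k) (Set.mem_univ _)
    rwa [f.injective.extend_apply] at this
  · have := h j (Set.mem_univ _)
    rwa [Function.extend_apply' _ _ _ (by simpa using hj)] at this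

lemma measurableSet_extend {α : Type*} [MeasurableSpace α] {n N : ℕ} {C : Set α}
    {A : Fin n → Set α} (hC : MeasurableSet C) (hA : ∀ k, MeasurableSet (A k))
    (f : Fin n ↪ Fin N) (j : Fin N) :
    MeasurableSet (Function.extend f A (fun _ => Cᶜ) j) := by
  by_cases hj : ∃ k, f k = j
  · obtain ⟨k, rfl⟩ := hj
    rw [f.injective.extend_apply]; exact hA k
  · rw [Function.extend_apply' _ _ _ hj]; exact hC.compl

lemma measurableSet_occupationSet {α : Type*} [MeasurableSpace α] {n N : ℕ} {C : Set α}
    {A : Fin n → Set α} (hC : MeasurableSet C) (hA : ∀ k, MeasurableSet (A k))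
    (f : Fin n ↪ Fin N) : MeasurableSet (occupationSet C A f) :=
  MeasurableSet.univ_pi fun j => measurableSet_extend hC hA f j

lemma measureReal_pi_univ {α : Type*} [MeasurableSpace α] {N : ℕ} (σ : Measure α)
    [IsProbabilityMeasure σ] (B : Fin N → Set α) :
    (Measure.pi fun _ : Fin N => σ).real (Set.univ.pi B) = ∏ j, σ.real (B j) := by
  simp only [Measure.real, Measure.pi_pi, ENNReal.toReal_prod]

lemma measureReal_occupationSet {α : Type*} [MeasurableSpace α] {n N : ℕ} (σ : Measure α)
    [IsProbabilityMeasure σ] {C : Set α} {A : Fin n → Set α} (hC : MeasurableSet C)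
    {s p : ℝ} (hs : σ.real C = s) (hp : ∀ k, σ.real (A k) = p) (f : Fin n ↪ Fin N) :
    (Measure.pi fun _ : Fin N => σ).real (occupationSet C A f) = p ^ n * (1 - s) ^ (N - n) := by
  classical
  rw [occupationSet, measureReal_pi_univ]
  have h : ∀ j, σ.real (Function.extend f A (fun _ => Cᶜ) j) =
      if j ∈ Finset.univ.map f then p else 1 - s := fun j => by
    by_cases hj : ∃ k, f k = j
    · obtain ⟨k, rfl⟩ := hj
      rw [f.injective.extend_apply, if_pos (by simp), hp]
    · rw [Function.extend_apply' _ _ _ hj, if_neg (by simpa using hj), probReal_compl_eq_one_sub hC,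
        hs]
  simp only [h]
  rw [Finset.prod_ite, Finset.prod_const, Finset.prod_const, Finset.filter_mem_eq_inter,
    Finset.univ_inter, Finset.card_map, Finset.card_univ, Fintype.card_fin]
  congr 2
  rw [Finset.filter_not, Finset.filter_mem_eq_inter, Finset.univ_inter,
    Finset.card_sdiff_of_subset (Finset.subset_univ _), Finset.card_map]
  simp

/-- The probability that one of many rare local patterns occurs in an i.i.d. sample. -/
lemma le_measureReal_iUnion_occupationSet {α : Type*} [MeasurableSpace α] {n N M : ℕ}
    (σ : Measure α) [IsProbabilityMeasure σ] {C : Fin M → Set α} {A : Fin M → Fin n → Set α}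
    (hC : ∀ i, MeasurableSet (C i)) (hA : ∀ i k, MeasurableSet (A i k))
    (hCd : Pairwise fun i i' => Disjoint (C i) (C i')) (hAC : ∀ i k, A i k ⊆ C i)
    (hAd : ∀ i, Pairwise fun k l => Disjoint (A i k) (A i l)) {s p : ℝ}
    (hs : ∀ i, σ.real (C i) = s) (hp : ∀ i k, σ.real (A i k) = p) (hs1 : s < 1)
    (hm : 0 < M * N.descFactorial n * (p ^ n * (1 - s) ^ (N - n))) :
    2 - 1 / (M * N.descFactorial n * (p ^ n * (1 - s) ^ (N - n))) - ((1 - s)⁻¹) ^ (2 * n) ≤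
      (Measure.pi fun _ : Fin N => σ).real
        (⋃ t : Fin M × (Fin n ↪ Fin N), occupationSet (C t.1) (A t.1) t.2) := by
  classical
  set P := Measure.pi fun _ : Fin N => σ with hP
  have hPE : ∀ t : Fin M × (Fin n ↪ Fin N), P.real (occupationSet (C t.1) (A t.1) t.2) =
      p ^ n * (1 - s) ^ (N - n) := fun t =>
    measureReal_occupationSet σ (hC _) (hs _) (hp _) _
  have hsum : ∑ t : Fin M × (Fin n ↪ Fin N), P.real (occupationSet (C t.1) (A t.1) t.2) =
      M * N.descFactorial n * (p ^ n * (1 - s) ^ (N - n)) := by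
    simp only [hPE, Finset.sum_const, Finset.card_univ, Fintype.card_prod, Fintype.card_fin,
      Fintype.card_embedding_eq, nsmul_eq_mul, Nat.cast_mul]
  have hs1' : 0 < 1 - s := by linarith
  rw [← hsum]
  refine second_moment_le_measureReal_iUnion P
    (fun t => measurableSet_occupationSet (hC _) (hA _) _) (by positivity) ?_ (by rwa [hsum])
  rintro ⟨i, f⟩ ⟨i', f'⟩ hne
  have hRHS : 0 ≤ ((1 - s)⁻¹) ^ (2 * n) * (P.real (occupationSet (C i) (A i) f) *
      P.real (occupationSet (C i') (A i') f')) := by positivity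
  by_cases hi : i = i'
  · subst hi
    have hff : f ≠ f' := fun h => hne (by rw [h])
    obtain ⟨k, hk⟩ : ∃ k, f k ≠ f' k := by
      by_contra! h
      exact hff (DFunLike.ext _ _ h)
    have hempty : occupationSet (C i) (A i) f ∩ occupationSet (C i) (A i) f' = ∅ := by
      refine Set.eq_empty_of_forall_notMem fun ω hω => ?_
      obtain ⟨h1, -⟩ := mem_occupationSet hω.1
      obtain ⟨h3, h4⟩ := mem_occupationSet hω.2
      by_cases hR : f k ∈ Set.range f'
      · obtain ⟨l, hl⟩ := hR
        have hkl : k ≠ l := by rintro rfl; exact hk hl.symm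
        exact Set.disjoint_left.1 (hAd i hkl) (h1 k) (hl ▸ h3 l)
      · exact h4 _ hR (hAC i k (h1 k))
    rw [hempty, measureReal_empty]
    exact hRHS
  · have hp0 : ∀ i k, 0 ≤ σ.real (A i k) := fun _ _ => measureReal_nonneg
    set g : (Fin n ↪ Fin N) → Fin N → ℝ := fun f j =>
      if j ∈ Finset.univ.map f then (1 - s)⁻¹ else 1 with hg
    have hgprod : ∀ f, ∏ j, g f j = ((1 - s)⁻¹) ^ n := fun f => by
      simp only [hg]
      rw [Finset.prod_ite, Finset.prod_const, Finset.prod_const_one, mul_one,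
        Finset.filter_mem_eq_inter, Finset.univ_inter, Finset.card_map, Finset.card_univ,
        Fintype.card_fin]
    have hpi : occupationSet (C i) (A i) f ∩ occupationSet (C i') (A i') f' =
        Set.univ.pi fun j => Function.extend f (A i) (fun _ => (C i)ᶜ) j ∩
          Function.extend f' (A i') (fun _ => (C i')ᶜ) j := Set.pi_inter_distrib.symm
    rw [hpi, measureReal_pi_univ]
    change _ ≤ ((1 - s)⁻¹) ^ (2 * n) * (P.real (Set.univ.pi _) * P.real (Set.univ.pi _))
    have hgg : ((1 - s)⁻¹) ^ (2 * n) = (∏ j, g f j) * ∏ j, g f' j := by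
      rw [hgprod, hgprod, ← pow_add, two_mul]
    rw [measureReal_pi_univ, measureReal_pi_univ, hgg, ← Finset.prod_mul_distrib,
      ← Finset.prod_mul_distrib, ← Finset.prod_mul_distrib]
    refine Finset.prod_le_prod (fun j _ => measureReal_nonneg) fun j _ => ?_
    have hone : σ.real (C i)ᶜ = 1 - s := by rw [probReal_compl_eq_one_sub (hC i), hs]
    have hone' : σ.real (C i')ᶜ = 1 - s := by rw [probReal_compl_eq_one_sub (hC i'), hs]
    by_cases hj : ∃ k, f k = j <;> by_cases hj' : ∃ k, f' k = j
    · obtain ⟨k, rfl⟩ := hj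
      obtain ⟨l, hl⟩ := hj'
      rw [f.injective.extend_apply]
      nth_rewrite 1 [← hl]
      rw [f'.injective.extend_apply]
      have : A i k ∩ A i' l = ∅ :=
        Set.disjoint_iff_inter_eq_empty.1 ((hCd hi).mono (hAC _ _) (hAC _ _))
      rw [this, measureReal_empty]
      have hg0 : ∀ f j, 0 ≤ g f j := fun f j => by
        simp only [hg]; split_ifs <;> positivity
      exact mul_nonneg (mul_nonneg (hg0 _ _) (hg0 _ _)) (by positivity)
    · obtain ⟨k, rfl⟩ := hj
      have hgk : g f (f k) = (1 - s)⁻¹ := if_pos (by simp)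
      have hgk' : g f' (f k) = 1 := if_neg (by simpa using hj')
      rw [f.injective.extend_apply, Function.extend_apply' _ _ _ hj', hgk, hgk', hone']
      refine (measureReal_mono Set.inter_subset_left).trans (le_of_eq ?_)
      field_simp
    · obtain ⟨k, rfl⟩ := hj'
      have hgk : g f' (f' k) = (1 - s)⁻¹ := if_pos (by simp)
      have hgk' : g f (f' k) = 1 := if_neg (by simpa using hj)
      rw [f'.injective.extend_apply, Function.extend_apply' _ _ _ hj, hgk, hgk', hone]
      refine (measureReal_mono Set.inter_subset_right).trans (le_of_eq ?_)
      field_simp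
    · have hgk : g f j = 1 := if_neg (by simpa using hj)
      have hgk' : g f' j = 1 := if_neg (by simpa using hj')
      rw [Function.extend_apply' _ _ _ hj, Function.extend_apply' _ _ _ hj', hgk, hgk', hone,
        hone', ← Set.compl_union, probReal_compl_eq_one_sub ((hC i).union (hC i')),
        measureReal_union (hCd hi) (hC i'), hs, hs]
      nlinarith [sq_nonneg s]

/-- The sphere of dimension at least one carries many disjoint caps of radius `r`. -/
lemma exists_disjoint_caps {d : ℕ} (hd : 1 ≤ d) {r : ℝ} (hr : 0 < r) (hr4 : r ≤ 1 / 4) :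
    ∃ M : ℕ, 1 / (4 * r) ≤ M ∧ ∃ u : Fin M → EuclideanSpace ℝ (Fin (d + 1)),
      (∀ i, ‖u i‖ = 1) ∧ Pairwise fun i j => Disjoint (ball (u i) r) (ball (u j) r) := by
  set M := ⌊1 / (2 * r)⌋₊ with hM
  have hM1 : 1 / (2 * r) < M + 1 := Nat.lt_floor_add_one _
  have hM2 : (M : ℝ) ≤ 1 / (2 * r) := Nat.floor_le (by positivity)
  refine ⟨M, ?_, ?_⟩
  · have h1 : 1 / (2 * r) = 2 * (1 / (4 * r)) := by field_simp; norm_num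
    have h2 : 1 ≤ 1 / (4 * r) := by rw [le_div_iff₀ (by positivity)]; linarith
    linarith
  let e : Fin (d + 1) := ⟨1, by omega⟩
  have he : e ≠ 0 := by simp [e, Fin.ext_iff]
  set t : Fin M → ℝ := fun i => 2 * r * (i : ℕ) with ht
  have ht1 : ∀ i, t i ^ 2 ≤ 1 := fun i => by
    have h1 : ((i : ℕ) : ℝ) ≤ M := by exact_mod_cast i.2.le
    have h2 : t i ≤ 1 := by
      calc t i ≤ 2 * r * (1 / (2 * r)) := by
            simp only [ht]; gcongr; exact h1.trans hM2
        _ = 1 := by field_simp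
    have h3 : 0 ≤ t i := by simp only [ht]; positivity
    exact pow_le_one₀ h3 h2
  refine ⟨fun i => EuclideanSpace.single 0 (t i) + EuclideanSpace.single e (√(1 - t i ^ 2)),
    fun i => ?_, fun i j hij => ?_⟩
  · have h : ‖(EuclideanSpace.single 0 (t i) + EuclideanSpace.single e (√(1 - t i ^ 2)) :
        EuclideanSpace ℝ (Fin (d + 1)))‖ ^ 2 = 1 := by
      rw [norm_add_sq_real]
      simp [EuclideanSpace.inner_single_left, he, Real.sq_sqrt (sub_nonneg.2 (ht1 i))]
    exact (pow_eq_one_iff_of_nonneg (norm_nonneg _) two_ne_zero).1 h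
  · refine ball_disjoint_ball ?_
    rw [dist_eq_norm]
    refine le_trans ?_ (PiLp.norm_apply_le _ 0)
    have h1 : (1 : ℝ) ≤ |((i : ℕ) : ℝ) - ((j : ℕ) : ℝ)| := by
      have h2 : (1 : ℤ) ≤ |((i : ℕ) : ℤ) - ((j : ℕ) : ℤ)| := by
        refine Int.one_le_abs (sub_ne_zero.2 ?_)
        exact_mod_cast fun h => hij (Fin.ext h)
      exact_mod_cast h2
    have h3 : ‖(EuclideanSpace.single 0 (t i) + EuclideanSpace.single e (√(1 - t i ^ 2)) -
        (EuclideanSpace.single 0 (t j) + EuclideanSpace.single e (√(1 - t j ^ 2))) :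
        EuclideanSpace ℝ (Fin (d + 1))) 0‖ = 2 * r * |((i : ℕ) : ℝ) - ((j : ℕ) : ℝ)| := by
      simp [he.symm, ht, ← mul_sub, abs_of_pos hr]
    rw [h3]
    nlinarith

lemma tendsto_log_div_self_atTop : Filter.Tendsto (fun N : ℕ => Real.log N / N) Filter.atTop
    (nhds 0) :=
  (Real.isLittleO_log_id_atTop.tendsto_div_nhds_zero).comp tendsto_natCast_atTop_atTop

lemma eventually_mul_log_le_sqrt (B : ℝ) :
    ∀ᶠ N : ℕ in Filter.atTop, B * Real.log N ≤ (N : ℝ) ^ (1 / 2 : ℝ) := by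
  have h := (isLittleO_log_rpow_atTop (r := 1 / 2) (by norm_num)).bound
    (c := (|B| + 1)⁻¹) (by positivity)
  filter_upwards [tendsto_natCast_atTop_atTop.eventually h, Filter.eventually_ge_atTop 1]
    with N hN hN1
  have hlog : 0 ≤ Real.log N := Real.log_natCast_nonneg N
  have hN' : Real.log N ≤ (|B| + 1)⁻¹ * (N : ℝ) ^ (1 / 2 : ℝ) := by
    rwa [Real.norm_of_nonneg hlog, Real.norm_of_nonneg (by positivity)] at hN
  calc B * Real.log N ≤ (|B| + 1) * Real.log N := by
        gcongr; linarith [le_abs_self B]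
    _ ≤ (|B| + 1) * ((|B| + 1)⁻¹ * (N : ℝ) ^ (1 / 2 : ℝ)) := by gcongr
    _ = (N : ℝ) ^ (1 / 2 : ℝ) := by field_simp

lemma exp_neg_two_mul_le_one_sub {s : ℝ} (h0 : 0 ≤ s) (h1 : s ≤ 1 / 2) :
    Real.exp (-(2 * s)) ≤ 1 - s := by
  have hpos : 0 < 1 - s := by linarith
  rw [← Real.le_log_iff_exp_le hpos]
  refine le_trans ?_ (Real.one_sub_inv_le_log_of_pos hpos)
  have : (1 - s)⁻¹ ≤ 1 + 2 * s := by
    rw [inv_le_iff_one_le_mul₀ hpos]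
    nlinarith
  linarith

/-- Once the number of caps, the cap measure and the target measure are of the appropriate
order, the second moment bound is at least `1 / 2`. -/
lemma eventually_half_le_second_moment {d : ℕ} (hd : 1 ≤ d) {c : ℝ} (hc : 0 < c) :
    ∀ᶠ N : ℕ in Filter.atTop, ∀ s p m : ℝ, 0 ≤ s → s ≤ 1 / (4 * d) * (Real.log N / N) →
      c * (Real.log N / N) ≤ p → c * (Real.log N / N) ^ (-(1 / d : ℝ)) ≤ m →
      s < 1 ∧ 0 < m * N.descFactorial (d + 1) * (p ^ (d + 1) * (1 - s) ^ (N - (d + 1))) ∧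
      1 / 2 ≤ 2 - 1 / (m * N.descFactorial (d + 1) *
        (p ^ (d + 1) * (1 - s) ^ (N - (d + 1)))) - ((1 - s)⁻¹) ^ (2 * (d + 1)) := by
  have hd0 : (0 : ℝ) < d := by exact_mod_cast hd
  set c' := c * (c / 2) ^ (d + 1) with hc'
  have hc'0 : 0 < c' := by positivity
  have hx := (tendsto_order.1 tendsto_log_div_self_atTop).2 (1 / (10 * (d + 1)))
    (by positivity)
  have hL : ∀ᶠ N : ℕ in Filter.atTop, 1 ≤ Real.log N :=
    (Real.tendsto_log_atTop.comp tendsto_natCast_atTop_atTop).eventually_ge_atTop 1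
  filter_upwards [hx, hL, Filter.eventually_ge_atTop (2 * (d + 1)),
    eventually_mul_log_le_sqrt ((4 / c') ^ (d : ℝ))] with N hx hL hN hsq s p m hs0 hs hp hm
  set L := Real.log N with hLdef
  have hN0 : (0 : ℝ) < N := by
    have : 0 < N := by omega
    exact_mod_cast this
  have hx0 : 0 < L / N := by positivity
  have hd1 : (1 : ℝ) ≤ d := by exact_mod_cast hd
  have hsx : s ≤ L / N := by
    refine hs.trans (mul_le_of_le_one_left hx0.le ?_)
    rw [div_le_one (by positivity)]; linarith
  have hs10 : s * (10 * (d + 1)) ≤ 1 := by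
    have := hsx.trans hx.le
    rwa [le_div_iff₀ (by positivity)] at this
  have hs2 : s ≤ 1 / 2 := by nlinarith
  have hsN : 2 * s * N ≤ 1 / (2 * d) * L := by
    calc 2 * s * N ≤ 2 * (1 / (4 * d) * (L / N)) * N := by gcongr
      _ = 1 / (2 * d) * L := by field_simp; norm_num
  have hpow : (N : ℝ) ^ (-(1 / (2 * d)) : ℝ) ≤ (1 - s) ^ (N - (d + 1)) := by
    calc (N : ℝ) ^ (-(1 / (2 * d)) : ℝ) = Real.exp (-(1 / (2 * d) * L)) := by
          rw [Real.rpow_def_of_pos hN0, ← hLdef]; ring_nf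
      _ ≤ Real.exp (-(2 * s * N)) := by gcongr
      _ = Real.exp (-(2 * s)) ^ N := by rw [← Real.exp_nat_mul]; ring_nf
      _ ≤ (1 - s) ^ N := by gcongr; exact exp_neg_two_mul_le_one_sub hs0 hs2
      _ ≤ (1 - s) ^ (N - (d + 1)) :=
          pow_le_pow_of_le_one (by linarith) (by linarith) (Nat.sub_le _ _)
  have hdesc : ((N : ℝ) / 2) ^ (d + 1) ≤ N.descFactorial (d + 1) := by
    have h1 : (((N + 1 - (d + 1)) ^ (d + 1) : ℕ) : ℝ) ≤ N.descFactorial (d + 1) := by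
      exact_mod_cast Nat.pow_sub_le_descFactorial N (d + 1)
    refine le_trans ?_ h1
    rw [Nat.cast_pow]
    gcongr
    rw [div_le_iff₀ two_pos]
    exact_mod_cast (by omega : N ≤ (N + 1 - (d + 1)) * 2)
  have hpp : (c / 2) ^ (d + 1) ≤ N.descFactorial (d + 1) * p ^ (d + 1) := by
    calc (c / 2) ^ (d + 1) ≤ (N / 2 * (c * (L / N))) ^ (d + 1) := by
          gcongr
          have : N / 2 * (c * (L / N)) = c / 2 * L := by field_simp
          rw [this]
          exact le_mul_of_one_le_right (by positivity) hL
      _ = (N / 2 : ℝ) ^ (d + 1) * (c * (L / N)) ^ (d + 1) := mul_pow _ _ _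
      _ ≤ N.descFactorial (d + 1) * p ^ (d + 1) := by gcongr
  have hy : 4 / c' ≤ (L / N) ^ (-(1 / d : ℝ)) * (N : ℝ) ^ (-(1 / (2 * d)) : ℝ) := by
    have h1 : (L / N) ^ (-(1 / d : ℝ)) * (N : ℝ) ^ (-(1 / (2 * d)) : ℝ) =
        ((N : ℝ) ^ (1 / 2 : ℝ) / L) ^ (1 / d : ℝ) := by
      rw [Real.rpow_neg hx0.le, ← Real.inv_rpow hx0.le, inv_div,
        Real.div_rpow hN0.le (by positivity), Real.div_rpow (by positivity) (by positivity),
        ← Real.rpow_mul hN0.le, div_mul_eq_mul_div, ← Real.rpow_add hN0]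
      congr 2
      field_simp
      norm_num
    rw [h1]
    calc 4 / c' = ((4 / c') ^ (d : ℝ)) ^ (1 / d : ℝ) := by
          rw [← Real.rpow_mul (by positivity), mul_one_div_cancel hd0.ne', Real.rpow_one]
      _ ≤ ((N : ℝ) ^ (1 / 2 : ℝ) / L) ^ (1 / d : ℝ) := by
          gcongr
          rw [le_div_iff₀ (by positivity)]
          exact hsq
  have hmain : 4 ≤ m * N.descFactorial (d + 1) *
      (p ^ (d + 1) * (1 - s) ^ (N - (d + 1))) := by
    calc (4 : ℝ) = c' * (4 / c') := by field_simp
      _ ≤ c' * ((L / N) ^ (-(1 / d : ℝ)) * (N : ℝ) ^ (-(1 / (2 * d)) : ℝ)) := by gcongr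
      _ = (c * (L / N) ^ (-(1 / d : ℝ))) * (c / 2) ^ (d + 1) *
          (N : ℝ) ^ (-(1 / (2 * d)) : ℝ) := by rw [hc']; ring
      _ ≤ m * (N.descFactorial (d + 1) * p ^ (d + 1)) * (1 - s) ^ (N - (d + 1)) := by
          have hm0 : 0 ≤ m := le_trans (by positivity) hm
          have : 0 ≤ p := le_trans (by positivity) hp
          gcongr
      _ = _ := by ring
  have hbern : 4 / 5 ≤ (1 - s) ^ (2 * (d + 1)) := by
    have := one_add_mul_le_pow (a := -s) (by linarith) (2 * (d + 1))
    push_cast at this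
    rw [← sub_eq_add_neg] at this
    refine le_trans ?_ this
    nlinarith
  refine ⟨by linarith, by linarith, ?_⟩
  have h4 : 1 / (m * N.descFactorial (d + 1) *
      (p ^ (d + 1) * (1 - s) ^ (N - (d + 1)))) ≤ 1 / 4 := by gcongr
  have h5 : ((1 - s)⁻¹) ^ (2 * (d + 1)) ≤ 5 / 4 := by
    rw [inv_pow]
    calc ((1 - s) ^ (2 * (d + 1)))⁻¹ ≤ (4 / 5 : ℝ)⁻¹ := by gcongr
      _ = 5 / 4 := by norm_num
  linarith

/-- Any nondegenerate simplex inscribed in the unit sphere of `ℝᵈ` gives a lower bound for the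
expected maximal facet volume. -/
lemma eventually_le_integral_maxFacetVol {d : ℕ} (hd : 1 ≤ d)
    (ζ : Fin (d + 1) → EuclideanSpace ℝ (Fin d)) (hζ : ∀ k, ‖ζ k‖ = 1)
    (hpos : 0 < μH[(d : ℝ)] (convexHull ℝ (Set.range ζ))) :
    ∀ᶠ N : ℕ in Filter.atTop,
      1 / 2 * ((μH[(d : ℝ)] (sphere (0 : EuclideanSpace ℝ (Fin (d + 1))) 1)).toReal /
        (4 * d * 2 ^ d * (μH[(d : ℝ)] (ball (0 : EuclideanSpace ℝ (Fin d)) 1)).toReal) *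
        (Real.log N / N) * (1 / 2) ^ (d + 1) *
          (μH[(d : ℝ)] (convexHull ℝ (Set.range ζ))).toReal) ≤
      ∫ ω, maxFacetVol (d + 1) (convexHull ℝ (Set.range ω))
        ∂(Measure.pi fun _ : Fin N => sphereUniform (d + 1)) := by
  have hd0 : (0 : ℝ) < d := by exact_mod_cast hd
  set h := (μH[(d : ℝ)] (ball (0 : EuclideanSpace ℝ (Fin d)) 1)).toReal with hh
  set H := (μH[(d : ℝ)] (sphere (0 : EuclideanSpace ℝ (Fin (d + 1))) 1)).toReal with hH
  have hh0 : 0 < h := ENNReal.toReal_pos (hausdorffMeasure_ball_pos_lt_top d).1.ne'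
    (hausdorffMeasure_ball_pos_lt_top d).2.ne
  have hH0 : 0 < H := ENNReal.toReal_pos (hausdorffMeasure_sphere_pos_lt_top d).1.ne'
    (hausdorffMeasure_sphere_pos_lt_top d).2.ne
  set α := H / (4 * d * 2 ^ d * h) with hα
  have hα0 : 0 < α := by positivity
  obtain ⟨ε, hε0, hε1, r₀, hr₀, hconf⟩ := exists_facet_configuration ζ hζ hpos
  set c := min ((ε / 2) ^ d * α * h / H) (1 / 4 * α ^ (-(1 / d : ℝ))) with hc
  have hc0 : 0 < c := by positivity
  have hx := (tendsto_order.1 tendsto_log_div_self_atTop).2 ((min r₀ (1 / 4)) ^ d / α)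
    (by positivity)
  filter_upwards [hx, Filter.eventually_ge_atTop 2, eventually_half_le_second_moment hd hc0]
    with N hx hN hsm
  set x := Real.log N / N with hxdef
  have hx0 : 0 < x := by
    have hN1 : (1 : ℝ) < N := by exact_mod_cast hN
    have := Real.log_pos hN1
    positivity
  set r := (α * x) ^ (1 / d : ℝ) with hr
  have hr0 : 0 < r := by positivity
  have hrd : r ^ d = α * x := by
    rw [hr, ← Real.rpow_natCast, ← Real.rpow_mul (by positivity), one_div_mul_cancel hd0.ne',
      Real.rpow_one]
  have hrle : r ≤ min r₀ (1 / 4) := by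
    refine le_of_pow_le_pow_left₀ (n := d) (by omega) (by positivity) ?_
    rw [hrd]
    rw [lt_div_iff₀ hα0] at hx
    linarith
  have hr4 : r ≤ 1 / 4 := hrle.trans (min_le_right _ _)
  obtain ⟨M, hM, u, hu, hud⟩ := exists_disjoint_caps hd hr0 hr4
  choose y hy hyu hyd hyfacet using fun i => hconf r hr0 (hrle.trans (min_le_left _ _)) (u i) (hu i)
  set σ := sphereUniform (d + 1) with hσ
  have hσp : IsProbabilityMeasure σ := isProbabilityMeasure_sphereUniform d
  set e : EuclideanSpace ℝ (Fin (d + 1)) := EuclideanSpace.single 0 1 with he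
  have he1 : ‖e‖ = 1 := by simp [he]
  have hball : ∀ v : EuclideanSpace ℝ (Fin (d + 1)), ‖v‖ = 1 → ∀ t,
      σ.real (ball v t) = σ.real (ball e t) := fun v hv t => by
    rw [Measure.real, Measure.real, hσ, sphereUniform_ball_eq hv he1 t]
  have hs : σ.real (ball e r) ≤ 1 / (4 * d) * x := by
    refine (sphereUniform_real_ball_le he1 hr0 (by linarith)).trans (le_of_eq ?_)
    rw [← hh, ← hH, mul_pow, hrd, hα]
    field_simp
  have hp : c * x ≤ σ.real (ball e (ε * r)) := by
    refine le_trans ?_ (le_sphereUniform_real_ball he1 (by positivity) (by nlinarith))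
    rw [← hh, ← hH]
    calc c * x ≤ ((ε / 2) ^ d * α * h / H) * x := by gcongr; exact min_le_left _ _
      _ = (ε * r / 2) ^ d * h / H := by
        rw [mul_div_right_comm ε r 2, mul_pow, hrd]; ring
  have hMc : c * x ^ (-(1 / d : ℝ)) ≤ M := by
    refine le_trans ?_ hM
    calc c * x ^ (-(1 / d : ℝ)) ≤ (1 / 4 * α ^ (-(1 / d : ℝ))) * x ^ (-(1 / d : ℝ)) := by
          gcongr; exact min_le_right _ _
      _ = 1 / (4 * r) := by
        rw [mul_assoc, ← Real.mul_rpow hα0.le hx0.le, Real.rpow_neg (by positivity), ← hr]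
        field_simp
  obtain ⟨hs1, hm0, hhalf⟩ := hsm _ _ _ measureReal_nonneg hs hp hMc
  have hprob := hhalf.trans (le_measureReal_iUnion_occupationSet σ (C := fun i => ball (u i) r)
    (A := fun i k => ball (y i k) (ε * r)) (fun _ => measurableSet_ball)
    (fun _ _ => measurableSet_ball) hud hyu hyd (fun i => hball _ (hu i) r)
    (fun i k => hball _ (hy i k) (ε * r)) hs1 hm0)
  set G := ⋃ t : Fin M × (Fin (d + 1) ↪ Fin N),
    occupationSet (ball (u t.1) r) (fun k => ball (y t.1 k) (ε * r)) t.2 with hG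
  have hGm : MeasurableSet G := MeasurableSet.iUnion fun t =>
    measurableSet_occupationSet measurableSet_ball (fun _ => measurableSet_ball) _
  set b := α * x * (1 / 2) ^ (d + 1) * (μH[(d : ℝ)] (convexHull ℝ (Set.range ζ))).toReal with hb
  have hb0 : 0 ≤ b := by positivity
  calc 1 / 2 * b ≤ (Measure.pi fun _ : Fin N => σ).real G * b := by gcongr
    _ = ∫ ω, G.indicator (fun _ => b) ω ∂(Measure.pi fun _ : Fin N => σ) := by
      rw [integral_indicator_const _ hGm, smul_eq_mul]
    _ ≤ _ := by
      refine integral_mono_ae ((integrable_const b).indicator hGm) (integrable_maxFacetVol d N) ?_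
      filter_upwards [ae_pi_of_ae (Fin N) (ae_mem_sphere d)] with ω hω
      by_cases hωG : ω ∈ G
      · rw [Set.indicator_of_mem hωG]
        obtain ⟨⟨i, f⟩, hif⟩ := Set.mem_iUnion.1 hωG
        obtain ⟨h1, h2⟩ := mem_occupationSet hif
        rw [hb, ← hrd]
        exact hyfacet i N ω hω f h1 h2
      · rw [Set.indicator_of_notMem hωG]
        exact maxFacetVol_nonneg _ _

lemma sq_integral_le_integral_sq {Ω : Type*} [MeasurableSpace Ω] {P : Measure Ω}
    [IsProbabilityMeasure P] {f : Ω → ℝ} (hf : Integrable f P)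
    (hf2 : Integrable (fun ω => f ω ^ 2) P) : (∫ ω, f ω ∂P) ^ 2 ≤ ∫ ω, f ω ^ 2 ∂P := by
  set m := ∫ ω, f ω ∂P with hm
  have h : 0 ≤ ∫ ω, (f ω ^ 2 - 2 * m * f ω + m ^ 2) ∂P :=
    integral_nonneg fun ω => by
      change 0 ≤ f ω ^ 2 - 2 * m * f ω + m ^ 2
      nlinarith [sq_nonneg (f ω - m)]
  have hi : Integrable (fun ω => 2 * m * f ω) P := hf.const_mul _
  have hi' : Integrable (fun ω => f ω ^ 2 - 2 * m * f ω) P := hf2.sub hi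
  rw [integral_add hi' (integrable_const _), integral_sub hf2 hi, integral_const_mul,
    ← hm, integral_const] at h
  simp only [probReal_univ, one_smul] at h
  linarith

/-- Some simplex inscribed in the unit sphere is at least as large as `V₁³ / V₂`. -/
lemma exists_simplex_moment_le {e : ℕ} (h1 : simplexMoment (e + 1 + 1) 1 ≠ 0)
    (h2 : simplexMoment (e + 1 + 1) 2 ≠ 0) :
    ∃ ζ : Fin (e + 1 + 1) → EuclideanSpace ℝ (Fin (e + 1)), (∀ k, ‖ζ k‖ = 1) ∧
      0 < (volume (convexHull ℝ (Set.range ζ))).toReal ∧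
      simplexMoment (e + 1 + 1) 1 ^ 3 / simplexMoment (e + 1 + 1) 2 ≤
        (volume (convexHull ℝ (Set.range ζ))).toReal := by
  set σ := sphereUniform (e + 1) with hσ
  have hσp : IsProbabilityMeasure σ := isProbabilityMeasure_sphereUniform e
  set P := Measure.pi fun _ : Fin (e + 1 + 1) => σ with hP
  set f : (Fin (e + 1 + 1) → EuclideanSpace ℝ (Fin (e + 1))) → ℝ := fun ζ =>
    (volume (convexHull ℝ (Set.range ζ))).toReal with hf
  have hV1 : simplexMoment (e + 1 + 1) 1 = ∫ ζ, f ζ ∂P := by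
    simp only [simplexMoment, pow_one]; rfl
  have hV2 : simplexMoment (e + 1 + 1) 2 = ∫ ζ, f ζ ^ 2 ∂P := rfl
  rw [hV1] at h1 ⊢
  rw [hV2] at h2 ⊢
  have hi1 : Integrable f P := Integrable.of_integral_ne_zero h1
  have hi2 : Integrable (fun ζ => f ζ ^ 2) P := Integrable.of_integral_ne_zero h2
  have hsq := sq_integral_le_integral_sq hi1 hi2
  have hpos : 0 < ∫ ζ, f ζ ∂P :=
    (integral_nonneg fun ζ => ENNReal.toReal_nonneg).lt_of_ne' h1
  have hpos2 : 0 < ∫ ζ, f ζ ^ 2 ∂P := lt_of_lt_of_le (by positivity) hsq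
  obtain ⟨ζ, hζ, hle⟩ := exists_notMem_null_integral_le hi1
    (ae_iff.1 (ae_pi_of_ae (Fin (e + 1 + 1)) (ae_mem_sphere e)))
  refine ⟨ζ, by simpa using hζ, hpos.trans_le hle, le_trans ?_ hle⟩
  rw [div_le_iff₀ hpos2]
  nlinarith

lemma hausdorffMeasure_toReal_mul_volume_ball (d : ℕ) (K : Set (EuclideanSpace ℝ (Fin d))) :
    (μH[(d : ℝ)] K).toReal * (volume (ball (0 : EuclideanSpace ℝ (Fin d)) 1)).toReal =
      (μH[(d : ℝ)] (ball (0 : EuclideanSpace ℝ (Fin d)) 1)).toReal * (volume K).toReal := by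
  have := hausdorffMeasure_isAddHaar d
  have hc := Measure.isAddLeftInvariant_eq_smul
    (μH[(d : ℝ)] : Measure (EuclideanSpace ℝ (Fin d))) volume
  rw [hc, Measure.smul_apply, Measure.smul_apply, ENNReal.toReal_smul, ENNReal.toReal_smul,
    NNReal.smul_def, NNReal.smul_def, smul_eq_mul, smul_eq_mul]
  ring

lemma facet_constant_le {d : ℕ} (hd : 1 ≤ d) :
    (2 : ℝ) ^ (((d + 1 : ℕ) : ℤ) ^ 2 - (d + 1 : ℕ) - 7) / ((3 : ℝ) ^ (d + 1 + 3) *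
      Real.pi ^ (2 * ((d + 1 : ℕ) : ℤ) ^ 2 - 3 * (d + 1 : ℕ) - 1)) ≤
      1 / (d * 2 ^ (2 * d + 4)) := by
  have hd0 : (0 : ℝ) < d := by exact_mod_cast hd
  have hdz : (1 : ℤ) ≤ d := by exact_mod_cast hd
  set a : ℤ := ((d + 1 : ℕ) : ℤ) ^ 2 - (d + 1 : ℕ) - 7 with ha
  set k : ℤ := 2 * ((d + 1 : ℕ) : ℤ) ^ 2 - 3 * (d + 1 : ℕ) - 1 with hk
  have hk0 : 0 ≤ k := by
    rw [hk]; push_cast; nlinarith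
  have hak : a - k ≤ -((2 * d + 4 : ℕ) : ℤ) := by
    rw [ha, hk]; push_cast; nlinarith [sq_nonneg ((d : ℤ) - 1)]
  have hpi : (2 : ℝ) ^ k ≤ Real.pi ^ k :=
    zpow_le_zpow_left₀ hk0 (by norm_num) Real.two_le_pi
  have h3 : (d : ℝ) ≤ 3 ^ (d + 1 + 3) := by
    have h : d < 3 ^ d := Nat.lt_pow_self (by norm_num)
    have h' : (d : ℝ) < 3 ^ d := by exact_mod_cast h
    exact h'.le.trans (pow_le_pow_right₀ (by norm_num) (by omega))
  calc (2 : ℝ) ^ a / ((3 : ℝ) ^ (d + 1 + 3) * Real.pi ^ k)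
      ≤ (2 : ℝ) ^ a / (d * 2 ^ k) := by gcongr
    _ = (2 : ℝ) ^ (a - k) / d := by rw [zpow_sub₀ two_ne_zero a k, mul_comm (d : ℝ), div_mul_eq_div_div]
    _ ≤ (2 : ℝ) ^ (-((2 * d + 4 : ℕ) : ℤ)) / d := by
      gcongr
      · norm_num
    _ = 1 / (d * 2 ^ (2 * d + 4)) := by
      rw [zpow_neg, zpow_natCast]; field_simp

theorem expected_max_facet_lower (n : ℕ) (hn : 3 ≤ n) :
    ∃ N₀ : ℕ, ∀ N : ℕ, N₀ ≤ N →
      ((μH[(n : ℝ) - 1] (sphere (0 : EuclideanSpace ℝ (Fin n)) 1)).toReal /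
            (volume (ball (0 : EuclideanSpace ℝ (Fin (n - 1))) 1)).toReal) *
          (simplexMoment n 1 ^ 3 / simplexMoment n 2) *
          ((2 : ℝ) ^ ((n : ℤ) ^ 2 - n - 7) /
            ((3 : ℝ) ^ (n + 3) * Real.pi ^ (2 * (n : ℤ) ^ 2 - 3 * n - 1))) *
          (Real.log N / N) ≤
        ∫ ω, maxFacetVol n (convexHull ℝ (Set.range ω))
          ∂(Measure.pi fun _ : Fin N => sphereUniform n) := by
  obtain ⟨e, rfl⟩ : ∃ e, n = e + 1 + 1 := ⟨n - 2, by omega⟩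
  by_cases h12 : simplexMoment (e + 1 + 1) 1 = 0 ∨ simplexMoment (e + 1 + 1) 2 = 0
  · refine ⟨0, fun N _ => ?_⟩
    have h0 : simplexMoment (e + 1 + 1) 1 ^ 3 / simplexMoment (e + 1 + 1) 2 = 0 := by
      rcases h12 with h | h <;> simp [h]
    rw [h0, mul_zero, zero_mul, zero_mul]
    exact integral_nonneg fun ω => maxFacetVol_nonneg _ _
  push Not at h12
  obtain ⟨ζ, hζ, hζ0, hζV⟩ := exists_simplex_moment_le h12.1 h12.2
  rw [natCast_succ_sub_one (e + 1)]
  change ∃ N₀ : ℕ, ∀ N : ℕ, N₀ ≤ N →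
      ((μH[((e + 1 : ℕ) : ℝ)] (sphere (0 : EuclideanSpace ℝ (Fin (e + 1 + 1))) 1)).toReal /
            (volume (ball (0 : EuclideanSpace ℝ (Fin (e + 1))) 1)).toReal) * _ * _ * _ ≤ _
  have hd : 1 ≤ e + 1 := by omega
  generalize hde : e + 1 = d at *
  have hd0 : (0 : ℝ) < d := by exact_mod_cast hd
  set S := (μH[(d : ℝ)] (sphere (0 : EuclideanSpace ℝ (Fin (d + 1))) 1)).toReal with hS
  set B := (volume (ball (0 : EuclideanSpace ℝ (Fin d)) 1)).toReal with hB
  set h := (μH[(d : ℝ)] (ball (0 : EuclideanSpace ℝ (Fin d)) 1)).toReal with hh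
  have hh0 : 0 < h := ENNReal.toReal_pos (hausdorffMeasure_ball_pos_lt_top d).1.ne'
    (hausdorffMeasure_ball_pos_lt_top d).2.ne
  have hB0 : 0 < B := ENNReal.toReal_pos (measure_ball_pos _ _ one_pos).ne'
    measure_ball_lt_top.ne
  have hconv := hausdorffMeasure_toReal_mul_volume_ball d (convexHull ℝ (Set.range ζ))
  rw [← hB, ← hh] at hconv
  have hpos : 0 < (μH[(d : ℝ)] (convexHull ℝ (Set.range ζ))).toReal := by
    refine pos_of_mul_pos_left ?_ hB0.le
    rw [hconv]
    positivity
  obtain ⟨N₀, hN₀⟩ := Filter.eventually_atTop.1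
    (eventually_le_integral_maxFacetVol hd ζ hζ (ENNReal.toReal_pos_iff.1 hpos).1)
  refine ⟨N₀, fun N hN => le_trans ?_ (hN₀ N hN)⟩
  have hlog : 0 ≤ Real.log N / N := div_nonneg (Real.log_natCast_nonneg N) (Nat.cast_nonneg N)
  calc S / B * (simplexMoment (d + 1) 1 ^ 3 / simplexMoment (d + 1) 2) * _ * (Real.log N / N)
      ≤ S / B * (volume (convexHull ℝ (Set.range ζ))).toReal * (1 / (d * 2 ^ (2 * d + 4))) *
          (Real.log N / N) := by
        exact mul_le_mul_of_nonneg_right (mul_le_mul (by gcongr) (facet_constant_le hd)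
          (by positivity) (by positivity)) hlog
    _ = _ := by
        rw [eq_div_of_mul_eq hB0.ne' hconv, ← hh, ← hS, one_div_pow]
        field_simp
        ring
end

section
/- Let ξ₁, ξ₂, ξ₃ be i.i.d. uniformly random points on the unit circle S¹ ⊂ ℝ². Then for all t ≥ 0, ℙ(area of the triangle [ξ₁,ξ₂,ξ₃] ≤ t) ≤ 342·t^{2/3}. -/
open MeasureTheory Metric Real

/-- The uniform probability measure on the unit circle `S¹ ⊂ ℝ²`. -/
noncomputable def sphereUniform2 : Measure (EuclideanSpace ℝ (Fin 2)) :=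
  (μH[(1 : ℝ)] (sphere (0 : EuclideanSpace ℝ (Fin 2)) 1))⁻¹ •
    (μH[(1 : ℝ)]).restrict (sphere (0 : EuclideanSpace ℝ (Fin 2)) 1)

open scoped ENNReal

/-- The point of the unit circle at angle `θ`. -/
noncomputable def circlePoint (θ : ℝ) : EuclideanSpace ℝ (Fin 2) := !₂[cos θ, sin θ]

lemma dist_sq_fin_two (x y : EuclideanSpace ℝ (Fin 2)) :
    dist x y ^ 2 = (x 0 - y 0) ^ 2 + (x 1 - y 1) ^ 2 := by
  rw [EuclideanSpace.dist_eq, Real.sq_sqrt (by positivity)]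
  simp [Real.dist_eq, sq_abs]

lemma mem_unit_sphere_iff (x : EuclideanSpace ℝ (Fin 2)) :
    x ∈ sphere (0 : EuclideanSpace ℝ (Fin 2)) 1 ↔ x 0 ^ 2 + x 1 ^ 2 = 1 := by
  have h := dist_sq_fin_two x 0
  simp only [PiLp.zero_apply, sub_zero] at h
  rw [mem_sphere, ← h, pow_eq_one_iff_of_nonneg dist_nonneg two_ne_zero]

lemma dist_sq_circlePoint (a b : ℝ) :
    dist (circlePoint a) (circlePoint b) ^ 2 = 2 - 2 * cos (a - b) := by
  rw [dist_sq_fin_two, cos_sub]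
  simp only [circlePoint, PiLp.toLp_apply, Matrix.cons_val_zero, Matrix.cons_val_one]
  linear_combination sin_sq_add_cos_sq a + sin_sq_add_cos_sq b

lemma lipschitzWith_circlePoint : LipschitzWith 1 circlePoint := by
  refine LipschitzWith.of_dist_le_mul fun a b => ?_
  rw [NNReal.coe_one, one_mul]
  refine le_of_sq_le_sq ?_ dist_nonneg
  rw [dist_sq_circlePoint, Real.dist_eq, sq_abs]
  linarith [one_sub_sq_div_two_le_cos (x := a - b)]

lemma exists_circlePoint_eq {x : EuclideanSpace ℝ (Fin 2)}
    (hx : x ∈ sphere (0 : EuclideanSpace ℝ (Fin 2)) 1) : ∃ θ, circlePoint θ = x := by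
  rw [mem_unit_sphere_iff] at hx
  have hn : ‖(⟨x 0, x 1⟩ : ℂ)‖ = 1 := by
    rw [Complex.norm_def, Complex.normSq_mk, ← sq, ← sq, hx, sqrt_one]
  have hz : (⟨x 0, x 1⟩ : ℂ) ≠ 0 := by
    rw [← norm_ne_zero_iff, hn]; exact one_ne_zero
  refine ⟨Complex.arg ⟨x 0, x 1⟩, ?_⟩
  ext i
  fin_cases i
  · simp [circlePoint, Complex.cos_arg hz, hn]
  · simp [circlePoint, Complex.sin_arg, hn]

/-- A point of the circle close to `circlePoint α` has an angle close to `α`. -/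
lemma sphere_inter_closedBall_subset (α r : ℝ) :
    sphere (0 : EuclideanSpace ℝ (Fin 2)) 1 ∩ closedBall (circlePoint α) r ⊆
      circlePoint '' Set.Icc (α - π / 2 * r) (α + π / 2 * r) := by
  rintro x ⟨hx, hxr⟩
  obtain ⟨β, rfl⟩ := exists_circlePoint_eq hx
  set δ := ((β - α : ℝ) : Angle).toReal with hδ
  have hcoe : ((α + δ : ℝ) : Angle) = (β : Angle) := by
    rw [Angle.coe_add, hδ, Angle.coe_toReal, ← Angle.coe_add]
    congr 1; ring
  have heq : circlePoint (α + δ) = circlePoint β := by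
    simp only [circlePoint, ← Angle.cos_coe, ← Angle.sin_coe, hcoe]
  refine ⟨α + δ, ?_, heq⟩
  have hd : dist (circlePoint (α + δ)) (circlePoint α) ≤ r := by
    rw [heq]; exact hxr
  have hr : 0 ≤ r := dist_nonneg.trans hd
  have hsq := pow_le_pow_left₀ dist_nonneg hd 2
  rw [dist_sq_circlePoint, add_sub_cancel_left] at hsq
  have hcos := cos_le_one_sub_mul_cos_sq (Angle.abs_toReal_le_pi ((β - α : ℝ) : Angle))
  rw [← hδ] at hcos
  have hpi := pi_pos
  have hbound : |δ| ≤ π / 2 * r := by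
    refine abs_le_of_sq_le_sq ?_ (by positivity)
    have h : 2 / π ^ 2 * δ ^ 2 ≤ r ^ 2 / 2 := by linarith
    have h' : δ ^ 2 = π ^ 2 / 2 * (2 / π ^ 2 * δ ^ 2) := by field_simp
    rw [h']
    calc _ ≤ π ^ 2 / 2 * (r ^ 2 / 2) := by gcongr
      _ = _ := by ring
  have := abs_le.1 hbound
  constructor <;> linarith

lemma hausdorffMeasure_circlePoint_image_le (s : Set ℝ) :
    μH[1] (circlePoint '' s) ≤ volume s := by
  simpa [hausdorffMeasure_real] using
    lipschitzWith_circlePoint.hausdorffMeasure_image_le zero_le_one s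

lemma two_le_hausdorffMeasure_sphere :
    2 ≤ μH[(1 : ℝ)] (sphere (0 : EuclideanSpace ℝ (Fin 2)) 1) := by
  have hl : LipschitzWith 1 (fun x : EuclideanSpace ℝ (Fin 2) => x 0) := by
    refine LipschitzWith.of_dist_le_mul fun x y => ?_
    rw [NNReal.coe_one, one_mul, dist_eq_norm, dist_eq_norm]
    exact PiLp.norm_apply_le (x - y) 0
  have h := hl.hausdorffMeasure_image_le zero_le_one (sphere (0 : EuclideanSpace ℝ (Fin 2)) 1)
  rw [hausdorffMeasure_real, ENNReal.coe_one, ENNReal.one_rpow, one_mul] at h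
  refine le_trans ?_ h
  have hsub : Set.Icc (-1 : ℝ) 1 ⊆
      (fun x : EuclideanSpace ℝ (Fin 2) => x 0) '' sphere (0 : EuclideanSpace ℝ (Fin 2)) 1 := by
    intro y hy
    refine ⟨!₂[y, √(1 - y ^ 2)], ?_, by simp⟩
    rw [mem_unit_sphere_iff]
    simp [Real.sq_sqrt (show 0 ≤ 1 - y ^ 2 by nlinarith [hy.1, hy.2])]
  refine le_trans ?_ (measure_mono hsub)
  norm_num [Real.volume_Icc]

lemma hausdorffMeasure_sphere_ne_top :
    μH[(1 : ℝ)] (sphere (0 : EuclideanSpace ℝ (Fin 2)) 1) ≠ ∞ := by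
  have hsub : sphere (0 : EuclideanSpace ℝ (Fin 2)) 1 ⊆
      circlePoint '' Set.Icc (0 - π / 2 * 2) (0 + π / 2 * 2) := by
    refine subset_trans (Set.subset_inter subset_rfl fun x hx => ?_)
      (sphere_inter_closedBall_subset 0 2)
    have h0 : ‖circlePoint 0‖ = 1 := by
      rw [← mem_sphere_zero_iff_norm, mem_unit_sphere_iff]; simp [circlePoint]
    rw [mem_closedBall, dist_eq_norm]
    refine (norm_sub_le _ _).trans ?_
    rw [h0, mem_sphere_zero_iff_norm.1 hx]; norm_num
  refine ne_top_of_le_ne_top ?_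
    ((measure_mono hsub).trans (hausdorffMeasure_circlePoint_image_le _))
  simp [Real.volume_Icc]

instance : IsProbabilityMeasure sphereUniform2 := by
  refine ⟨?_⟩
  rw [sphereUniform2, Measure.smul_apply, Measure.restrict_apply_univ, smul_eq_mul]
  refine ENNReal.inv_mul_cancel ?_ hausdorffMeasure_sphere_ne_top
  exact (lt_of_lt_of_le (by norm_num) two_le_hausdorffMeasure_sphere).ne'

lemma ae_mem_sphere_sphereUniform2 :
    ∀ᵐ x ∂sphereUniform2, x ∈ sphere (0 : EuclideanSpace ℝ (Fin 2)) 1 :=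
  Measure.ae_smul_measure (ae_restrict_mem isClosed_sphere.measurableSet) _

lemma sphereUniform2_closedBall_le {p : EuclideanSpace ℝ (Fin 2)}
    (hp : p ∈ sphere (0 : EuclideanSpace ℝ (Fin 2)) 1) (r : ℝ) :
    sphereUniform2 (closedBall p r) ≤ ENNReal.ofReal (π / 2 * r) := by
  obtain ⟨α, rfl⟩ := exists_circlePoint_eq hp
  rw [sphereUniform2, Measure.smul_apply, Measure.restrict_apply isClosed_closedBall.measurableSet,
    smul_eq_mul, Set.inter_comm]
  calc _ ≤ (2 : ℝ≥0∞)⁻¹ * ENNReal.ofReal (2 * (π / 2 * r)) := by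
        gcongr
        · exact two_le_hausdorffMeasure_sphere
        · refine (measure_mono (sphere_inter_closedBall_subset α r)).trans
            ((hausdorffMeasure_circlePoint_image_le _).trans_eq ?_)
          rw [Real.volume_Icc]; congr 1; ring
    _ = _ := by
        rw [ENNReal.ofReal_mul zero_le_two, ENNReal.ofReal_ofNat, ← mul_assoc,
          ENNReal.inv_mul_cancel two_ne_zero ENNReal.ofNat_ne_top, one_mul]

/-- A triangle contains a parallelogram spanned by two of its half-edges. -/
lemma abs_det_div_four_le_volume_convexHull (ξ : Fin 3 → EuclideanSpace ℝ (Fin 2)) :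
    |(ξ 1 0 - ξ 0 0) * (ξ 2 1 - ξ 0 1) - (ξ 1 1 - ξ 0 1) * (ξ 2 0 - ξ 0 0)| / 4 ≤
      (volume (convexHull ℝ (Set.range ξ))).toReal := by
  set v : Fin 2 → EuclideanSpace ℝ (Fin 2) :=
    ![(1 / 2 : ℝ) • (ξ 1 - ξ 0), (1 / 2 : ℝ) • (ξ 2 - ξ 0)] with hv
  have hfin : volume (convexHull ℝ (Set.range ξ)) ≠ ∞ :=
    ((isBounded_convexHull.2 (Set.finite_range ξ).isBounded).measure_lt_top).ne
  have hsub : (fun x => ξ 0 + x) '' parallelepiped v ⊆ convexHull ℝ (Set.range ξ) := by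
    rintro _ ⟨_, ht, rfl⟩
    obtain ⟨s, hs, rfl⟩ := (mem_parallelepiped_iff _ _).1 ht
    have a0 := hs.1 0
    have a1 := hs.1 1
    have b0 := hs.2 0
    have b1 := hs.2 1
    simp only [Pi.zero_apply, Pi.one_apply] at a0 a1 b0 b1
    have hc := (convex_convexHull ℝ (Set.range ξ)).sum_mem (t := Finset.univ)
      (w := ![1 - s 0 / 2 - s 1 / 2, s 0 / 2, s 1 / 2]) (z := ξ)
      (by
        intro i _
        fin_cases i <;> simp <;> linarith)
      (by simp [Fin.sum_univ_three]; ring)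
      (fun i _ => subset_convexHull ℝ _ (Set.mem_range_self i))
    convert hc using 1
    simp only [Fin.sum_univ_three, Fin.sum_univ_two, hv, Matrix.cons_val_zero, Matrix.cons_val_one,
      Matrix.cons_val]
    module
  have hvol : volume (parallelepiped v) = ENNReal.ofReal
      (|(ξ 1 0 - ξ 0 0) * (ξ 2 1 - ξ 0 1) - (ξ 1 1 - ξ 0 1) * (ξ 2 0 - ξ 0 0)| / 4) := by
    rw [← (EuclideanSpace.basisFun (Fin 2) ℝ).addHaar_eq_volume, Measure.addHaar_parallelepiped]
    congr 1
    rw [Module.Basis.det_apply, Matrix.det_fin_two]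
    simp only [Module.Basis.toMatrix_apply, hv, OrthonormalBasis.coe_toBasis_repr_apply,
      EuclideanSpace.basisFun_repr, Matrix.cons_val_zero, Matrix.cons_val_one,
      PiLp.smul_apply, PiLp.sub_apply, smul_eq_mul]
    rw [← abs_of_pos (show (0 : ℝ) < 4 by norm_num), ← abs_div]
    congr 1
    ring
  rw [← ENNReal.ofReal_le_iff_le_toReal hfin, ← hvol]
  refine le_trans (le_of_eq ?_) (measure_mono hsub)
  rw [Set.image_add_left, measure_preimage_add]

/-- Twice the area of a triangle inscribed in the unit circle is half the product of its sides. -/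
lemma two_mul_abs_det_eq_mul_dist {p q r : EuclideanSpace ℝ (Fin 2)}
    (hp : p ∈ sphere (0 : EuclideanSpace ℝ (Fin 2)) 1)
    (hq : q ∈ sphere (0 : EuclideanSpace ℝ (Fin 2)) 1)
    (hr : r ∈ sphere (0 : EuclideanSpace ℝ (Fin 2)) 1) :
    2 * |(q 0 - p 0) * (r 1 - p 1) - (q 1 - p 1) * (r 0 - p 0)| =
      dist p q * dist p r * dist q r := by
  rw [mem_unit_sphere_iff] at hp hq hr
  refine (pow_left_inj₀ (by positivity) (by positivity) two_ne_zero).1 ?_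
  rw [mul_pow, sq_abs, mul_pow, mul_pow, dist_sq_fin_two, dist_sq_fin_two, dist_sq_fin_two]
  obtain ⟨u, hu⟩ : ∃ u, u = q 0 - p 0 := ⟨_, rfl⟩
  obtain ⟨u', hu'⟩ : ∃ u, u = q 1 - p 1 := ⟨_, rfl⟩
  obtain ⟨v, hv⟩ : ∃ u, u = r 0 - p 0 := ⟨_, rfl⟩
  obtain ⟨v', hv'⟩ : ∃ u, u = r 1 - p 1 := ⟨_, rfl⟩
  have hA : p 0 * u + p 1 * u' = -(u ^ 2 + u' ^ 2) / 2 := by subst hu hu'; linarith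
  have hB : p 0 * v + p 1 * v' = -(v ^ 2 + v' ^ 2) / 2 := by subst hv hv'; linarith
  have hD : (u * v' - u' * v) ^ 2 * (p 0 ^ 2 + p 1 ^ 2) =
      ((p 0 * u + p 1 * u') * v - (p 0 * v + p 1 * v') * u) ^ 2 +
      ((p 0 * u + p 1 * u') * v' - (p 0 * v + p 1 * v') * u') ^ 2 := by ring
  rw [hA, hB, hp, mul_one] at hD
  rw [show p 0 - q 0 = -u by linarith, show p 1 - q 1 = -u' by linarith,
    show p 0 - r 0 = -v by linarith, show p 1 - r 1 = -v' by linarith,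
    show q 0 - r 0 = u - v by linarith, show q 1 - r 1 = u' - v' by linarith,
    ← hu, ← hu', ← hv, ← hv', hD]
  ring

lemma lintegral_min_dist_le {p : EuclideanSpace ℝ (Fin 2)}
    (hp : p ∈ sphere (0 : EuclideanSpace ℝ (Fin 2)) 1) {r : ℝ} (hr : 0 ≤ r) :
    ∫⁻ x, ENNReal.ofReal (min (dist p x) (r ^ 3 / dist p x ^ 2)) ∂sphereUniform2 ≤
      ENNReal.ofReal (π * r ^ 2) := by
  have hint : IntervalIntegrable (fun y : ℝ => π / 2 * √(r ^ 3) * y ^ (-(1 / 2) : ℝ))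
      volume 0 r :=
    (intervalIntegral.intervalIntegrable_rpow' (by norm_num)).const_mul _
  rw [lintegral_eq_lintegral_meas_le _ (ae_of_all _ fun x => by positivity)
    (by fun_prop : Measurable fun x => min (dist p x) (r ^ 3 / dist p x ^ 2)).aemeasurable]
  calc ∫⁻ y in Set.Ioi 0, sphereUniform2 {x | y ≤ min (dist p x) (r ^ 3 / dist p x ^ 2)}
      ≤ ∫⁻ y in Set.Ioi 0, (Set.Ioc 0 r).indicator
          (fun y => ENNReal.ofReal (π / 2 * √(r ^ 3) * y ^ (-(1 / 2) : ℝ))) y := by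
        refine setLIntegral_mono' measurableSet_Ioi fun y hy => ?_
        have hy : 0 < y := hy
        by_cases hyr : y ≤ r
        · rw [Set.indicator_of_mem (Set.mem_Ioc.2 ⟨hy, hyr⟩)]
          have hsub : {x | y ≤ min (dist p x) (r ^ 3 / dist p x ^ 2)} ⊆
              closedBall p (√(r ^ 3 / y)) := by
            intro x hx
            obtain ⟨h1, h2⟩ := le_min_iff.1 (Set.mem_ofPred.1 hx)
            have hd : 0 < dist p x := hy.trans_le h1
            rw [mem_closedBall, dist_comm]
            refine Real.le_sqrt_of_sq_le ?_
            rw [le_div_iff₀ (by positivity)] at h2 ⊢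
            linarith
          refine (measure_mono hsub).trans ((sphereUniform2_closedBall_le hp _).trans_eq ?_)
          rw [Real.sqrt_div (by positivity), Real.rpow_neg hy.le, ← Real.sqrt_eq_rpow,
            div_eq_mul_inv _ √y, mul_assoc]
        · rw [Set.indicator_of_notMem (fun h => hyr h.2)]
          refine (measure_mono_null (fun x hx => hyr ?_) measure_empty).le
          obtain ⟨h1, h2⟩ := le_min_iff.1 (Set.mem_ofPred.1 hx)
          rcases le_total (dist p x) r with h | h
          · exact h1.trans h
          · have hd : 0 < dist p x := hy.trans_le h1
            refine h2.trans ?_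
            rw [div_le_iff₀ (by positivity), pow_succ']
            gcongr
    _ = ENNReal.ofReal (∫ y in (0)..r, π / 2 * √(r ^ 3) * y ^ (-(1 / 2) : ℝ)) := by
        rw [lintegral_indicator measurableSet_Ioc, Measure.restrict_restrict measurableSet_Ioc,
          Set.inter_eq_left.2 Set.Ioc_subset_Ioi_self, intervalIntegral.integral_of_le hr,
          ofReal_integral_eq_lintegral_ofReal
            ((intervalIntegrable_iff_integrableOn_Ioc_of_le hr).1 hint)]
        filter_upwards [ae_restrict_mem measurableSet_Ioc] with y hy
        have := hy.1.le
        positivity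
    _ = ENNReal.ofReal (π * r ^ 2) := by
        congr 1
        rw [intervalIntegral.integral_const_mul, integral_rpow (Or.inl (by norm_num)),
          show (-(1 / 2) + 1 : ℝ) = 1 / 2 by norm_num, ← Real.sqrt_eq_rpow,
          Real.zero_rpow (by norm_num), sub_zero]
        have h : √(r ^ 3) * √r = r ^ 2 := by
          rw [← Real.sqrt_mul (by positivity), ← pow_succ, show r ^ (3 + 1) = (r ^ 2) ^ 2 by ring,
            Real.sqrt_sq (by positivity)]
        rw [← h]; ring

/-- The pairs `(x, y)` such that `x` is at least as close to `p` as `y` is, and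
`dist p x * dist p y ^ 2` is at most `r ^ 3`. -/
def closePairs (r : ℝ) (p : EuclideanSpace ℝ (Fin 2)) :
    Set (EuclideanSpace ℝ (Fin 2) × EuclideanSpace ℝ (Fin 2)) :=
  {z | dist p z.1 ≤ dist p z.2 ∧ dist p z.1 * dist p z.2 ^ 2 ≤ r ^ 3}

lemma measurableSet_closeTriples (r : ℝ) :
    MeasurableSet {z : EuclideanSpace ℝ (Fin 2) ×
      (EuclideanSpace ℝ (Fin 2) × EuclideanSpace ℝ (Fin 2)) | z.2 ∈ closePairs r z.1} := by
  refine IsClosed.measurableSet ?_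
  simp only [closePairs, Set.mem_ofPred_eq]
  exact (isClosed_le (by fun_prop) (by fun_prop)).and (isClosed_le (by fun_prop) (by fun_prop))

lemma measurableSet_closePairs (r : ℝ) (p : EuclideanSpace ℝ (Fin 2)) :
    MeasurableSet (closePairs r p) :=
  measurable_prodMk_left (x := p) (measurableSet_closeTriples r)

lemma prod_closePairs_le {p : EuclideanSpace ℝ (Fin 2)}
    (hp : p ∈ sphere (0 : EuclideanSpace ℝ (Fin 2)) 1) {r : ℝ} (hr : 0 ≤ r) :
    (sphereUniform2.prod sphereUniform2) (closePairs r p) ≤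
      ENNReal.ofReal (π ^ 2 / 2 * r ^ 2) := by
  rw [Measure.prod_apply_symm (measurableSet_closePairs r p)]
  calc _ ≤ ∫⁻ y, ENNReal.ofReal (π / 2) *
          ENNReal.ofReal (min (dist p y) (r ^ 3 / dist p y ^ 2)) ∂sphereUniform2 := by
        refine lintegral_mono fun y => ?_
        rw [← ENNReal.ofReal_mul (by positivity)]
        refine (measure_mono ?_).trans (sphereUniform2_closedBall_le hp _)
        rintro x ⟨h1, h2⟩
        simp only at h1 h2
        rw [mem_closedBall, dist_comm]
        refine le_min h1 ?_
        rcases (dist_nonneg (x := p) (y := y)).eq_or_lt with h | h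
        · rw [← h] at h1 ⊢
          simpa using h1
        · rwa [le_div_iff₀ (by positivity)]
    _ ≤ ENNReal.ofReal (π / 2) * ENNReal.ofReal (π * r ^ 2) := by
        rw [lintegral_const_mul _ (by fun_prop)]
        gcongr
        exact lintegral_min_dist_le hp hr
    _ = _ := by
        rw [← ENNReal.ofReal_mul (by positivity)]
        congr 1; ring

lemma pi_closePairs_le (e : Equiv.Perm (Fin 3)) {r : ℝ} (hr : 0 ≤ r) :
    (Measure.pi fun _ : Fin 3 => sphereUniform2)
        {ξ | (ξ (e 1), ξ (e 2)) ∈ closePairs r (ξ (e 0))} ≤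
      ENNReal.ofReal (π ^ 2 / 2 * r ^ 2) := by
  have hperm := measurePreserving_piCongrLeft (fun _ : Fin 3 => sphereUniform2) e
  have hsplit := (MeasurePreserving.prod (MeasurePreserving.id sphereUniform2)
    (measurePreserving_finTwoArrow sphereUniform2)).comp
    (measurePreserving_piFinSuccAbove (fun _ : Fin 3 => sphereUniform2) 0)
  have hpre : (MeasurableEquiv.piCongrLeft (fun _ => EuclideanSpace ℝ (Fin 2)) e) ⁻¹'
        {ξ | (ξ (e 1), ξ (e 2)) ∈ closePairs r (ξ (e 0))} =
      (Prod.map id MeasurableEquiv.finTwoArrow ∘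
        MeasurableEquiv.piFinSuccAbove (fun _ : Fin 3 => EuclideanSpace ℝ (Fin 2)) 0) ⁻¹'
        {z | z.2 ∈ closePairs r z.1} := by
    ext ξ
    have h (i : Fin 3) : (MeasurableEquiv.piCongrLeft (fun _ => EuclideanSpace ℝ (Fin 2)) e) ξ
        (e i) = ξ i := Equiv.piCongrLeft_apply_apply (fun _ => EuclideanSpace ℝ (Fin 2)) e ξ i
    simp only [Set.mem_preimage, Set.mem_ofPred_eq, h]
    rfl
  rw [← hperm.measure_preimage_equiv, hpre,
    hsplit.measure_preimage (measurableSet_closeTriples r).nullMeasurableSet,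
    Measure.prod_apply (measurableSet_closeTriples r)]
  calc _ ≤ ∫⁻ _, ENNReal.ofReal (π ^ 2 / 2 * r ^ 2) ∂sphereUniform2 := by
        refine lintegral_mono_ae ?_
        filter_upwards [ae_mem_sphere_sphereUniform2] with p hp
        exact prod_closePairs_le hp hr
    _ = _ := by simp

/-- If the product of the sides of a triangle is small, then some vertex sees a close pair. -/
lemma mem_closePairs_of_mul_dist_le {p q s : EuclideanSpace ℝ (Fin 2)} {r : ℝ}
    (h : dist p q * dist p s * dist q s ≤ r ^ 3 / 2) :
    (q, s) ∈ closePairs r p ∨ (s, q) ∈ closePairs r p ∨ (s, p) ∈ closePairs r q := by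
  have key {a b c : ℝ} (ha : 0 ≤ a) (hb : 0 ≤ b) (hbc : b ≤ 2 * c)
      (habc : a * b * c ≤ r ^ 3 / 2) : a * b ^ 2 ≤ r ^ 3 := by
    nlinarith [mul_le_mul_of_nonneg_left hbc (mul_nonneg ha hb)]
  have hpq := dist_triangle p s q
  have hps := dist_triangle p q s
  rw [dist_comm s q] at hpq
  simp only [closePairs, Set.mem_ofPred_eq, dist_comm q p]
  rcases le_total (dist p q) (dist p s) with h1 | h1
  · rcases le_total (dist p q) (dist q s) with h2 | h2
    · exact Or.inl ⟨h1, key dist_nonneg dist_nonneg (by linarith) h⟩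
    · exact Or.inr (Or.inr ⟨h2, key (c := dist p s) dist_nonneg dist_nonneg (by linarith)
        (by linarith)⟩)
  · rcases le_total (dist p s) (dist q s) with h2 | h2
    · exact Or.inr (Or.inl ⟨h1, key (c := dist q s) dist_nonneg dist_nonneg (by linarith)
        (by linarith)⟩)
    · exact Or.inr (Or.inr ⟨h2.trans h1, key (c := dist p s) dist_nonneg dist_nonneg (by linarith)
        (by linarith)⟩)

theorem triangle_area_cdf_upper (t : ℝ) (ht0 : 0 ≤ t) :
    (Measure.pi fun _ : Fin 3 => sphereUniform2)
        {ξ | (volume (convexHull ℝ (Set.range ξ))).toReal ≤ t} ≤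
      ENNReal.ofReal (342 * t ^ ((2 : ℝ) / 3)) := by
  set P := Measure.pi fun _ : Fin 3 => sphereUniform2
  obtain ⟨r, hr, hr3, hr2⟩ : ∃ r : ℝ, 0 ≤ r ∧ r ^ 3 = 16 * t ∧ r ^ 2 ≤ 16 * t ^ ((2 : ℝ) / 3) := by
    refine ⟨(16 * t) ^ ((1 : ℝ) / 3), by positivity, ?_, ?_⟩
    · rw [← Real.rpow_natCast, ← Real.rpow_mul (by positivity)]
      norm_num
    · rw [← Real.rpow_natCast, ← Real.rpow_mul (by positivity),
        Real.mul_rpow (by norm_num) ht0]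
      norm_num only
      gcongr
      exact Real.rpow_le_self_of_one_le (by norm_num) (by norm_num)
  let E (e : Equiv.Perm (Fin 3)) : Set (Fin 3 → EuclideanSpace ℝ (Fin 2)) :=
    {ξ | (ξ (e 1), ξ (e 2)) ∈ closePairs r (ξ (e 0))}
  have hE (e : Equiv.Perm (Fin 3)) : P (E e) ≤ ENNReal.ofReal (π ^ 2 / 2 * r ^ 2) :=
    pi_closePairs_le e hr
  have hsphere : ∀ᵐ ξ ∂P, ∀ i, ξ i ∈ sphere (0 : EuclideanSpace ℝ (Fin 2)) 1 :=
    ae_all_iff.2 fun i =>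
      (Measure.quasiMeasurePreserving_eval _ i).ae ae_mem_sphere_sphereUniform2
  have hcover : {ξ | (volume (convexHull ℝ (Set.range ξ))).toReal ≤ t} ≤ᵐ[P]
      (E 1 ∪ (E (Equiv.swap 1 2) ∪ E (finRotate 3)) : Set _) := by
    filter_upwards [hsphere] with ξ hξ (hvol : _ ≤ t)
    have hdet := abs_det_div_four_le_volume_convexHull ξ
    have hdist := two_mul_abs_det_eq_mul_dist (hξ 0) (hξ 1) (hξ 2)
    exact mem_closePairs_of_mul_dist_le (p := ξ 0) (q := ξ 1) (s := ξ 2) (r := r) (by linarith)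
  calc _ ≤ P (E 1 ∪ (E (Equiv.swap 1 2) ∪ E (finRotate 3))) := measure_mono_ae hcover
    _ ≤ ENNReal.ofReal (π ^ 2 / 2 * r ^ 2) + (ENNReal.ofReal (π ^ 2 / 2 * r ^ 2) +
        ENNReal.ofReal (π ^ 2 / 2 * r ^ 2)) :=
      (measure_union_le _ _).trans (add_le_add (hE _)
        ((measure_union_le _ _).trans (add_le_add (hE _) (hE _))))
    _ ≤ _ := by
      rw [← ENNReal.ofReal_add (by positivity) (by positivity),
        ← ENNReal.ofReal_add (by positivity) (by positivity)]
      refine ENNReal.ofReal_le_ofReal ?_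
      have hpi : π ^ 2 ≤ 3.15 ^ 2 := by
        have := pi_lt_d2
        gcongr
      have h := mul_le_mul hpi hr2 (by positivity) (by positivity)
      have := Real.rpow_nonneg ht0 ((2 : ℝ) / 3)
      nlinarith
end
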